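/- For every T > 0 there exist infinitely many pairs (ρ, v) with ρ ∈ L^∞(𝕋² × ℝ) and v ∈ L^∞(ℝ; L²(𝕋²; ℝ²)) that are weak solutions of the incompressible porous media equation on 𝕋² × ℝ and satisfy: |ρ(x,t)| = 1 for a.e. (x,t) ∈ 𝕋² × (0,T), and ρ(x,t) = 0 and v(x,t) = 0 for a.e. (x,t) with t < 0 or t > T. -/

import Mathlib

open MeasureTheory Filter

/-- Partial derivative in x₁ of a function of (x₁, x₂, t). -/
noncomputable def dx1 (f : ℝ × ℝ × ℝ → ℝ) (p : ℝ × ℝ × ℝ) : ℝ :=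
  deriv (fun s => f (s, p.2.1, p.2.2)) p.1

/-- Partial derivative in x₂ of a function of (x₁, x₂, t). -/
noncomputable def dx2 (f : ℝ × ℝ × ℝ → ℝ) (p : ℝ × ℝ × ℝ) : ℝ :=
  deriv (fun s => f (p.1, s, p.2.2)) p.2.1

/-- Partial derivative in t of a function of (x₁, x₂, t). -/
noncomputable def dt (f : ℝ × ℝ × ℝ → ℝ) (p : ℝ × ℝ × ℝ) : ℝ :=
  deriv (fun s => f (p.1, p.2.1, s)) p.2.2

/-- A function on ℝ² × ℝ is 1-periodic in both spatial variables, i.e. lives on 𝕋² × ℝ. -/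
def SpacePeriodic {α : Type*} (f : ℝ × ℝ × ℝ → α) : Prop :=
  ∀ p : ℝ × ℝ × ℝ, f (p.1 + 1, p.2.1, p.2.2) = f p ∧ f (p.1, p.2.1 + 1, p.2.2) = f p

/-- Test functions for the weak formulation on 𝕋² × ℝ: smooth, 1-periodic in
space, and compactly supported in time. -/
def TestPer (φ : ℝ × ℝ × ℝ → ℝ) : Prop :=
  ContDiff ℝ (⊤ : ℕ∞) φ ∧ SpacePeriodic φ ∧ ∃ R : ℝ, ∀ p : ℝ × ℝ × ℝ, R ≤ |p.2.2| → φ p = 0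

/-- A fundamental domain 𝕋² × ℝ ≅ (0,1)² × ℝ for the periodic problem. -/
def QT : Set (ℝ × ℝ × ℝ) := Set.Ioo (0 : ℝ) 1 ×ˢ (Set.Ioo (0 : ℝ) 1 ×ˢ (Set.univ : Set ℝ))

/-- (ρ, v) is a weak solution of the incompressible porous media equation on 𝕋² × ℝ:
for every smooth spatially periodic test function φ compactly supported in time,
(i) ∫∫ ρ(∂_t φ + v·∇_x φ) = 0, (ii) ∫∫ v·∇_x φ = 0, and
(iii) ∫∫ (v + (0,ρ))·∇_x^⊥ φ = 0, where ∇^⊥ = (−∂_{x₂}, ∂_{x₁}). -/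
def WeakIPMTorus (ρ : ℝ × ℝ × ℝ → ℝ) (v : ℝ × ℝ × ℝ → ℝ × ℝ) : Prop :=
  ∀ φ : ℝ × ℝ × ℝ → ℝ, TestPer φ →
    (∫ p in QT, ρ p * (dt φ p + (v p).1 * dx1 φ p + (v p).2 * dx2 φ p)) = 0 ∧
    (∫ p in QT, ((v p).1 * dx1 φ p + (v p).2 * dx2 φ p)) = 0 ∧
    (∫ p in QT, ((v p).1 * (-(dx2 φ p)) + ((v p).2 + ρ p) * dx1 φ p)) = 0

namespace IPM

open Topology Metric
open scoped ContDiff ENNReal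

section Calculus

lemma integrable_mul_of_hasCompactSupport {X : Type*} [TopologicalSpace X] [MeasurableSpace X]
    [OpensMeasurableSpace X] (μ : Measure X) [IsFiniteMeasureOnCompacts μ]
    {f g : X → ℝ} (hf : Continuous f)
    (hfc : HasCompactSupport f) (hg : Continuous g) : Integrable (fun x => f x * g x) μ :=
  (hf.mul hg).integrable_of_hasCompactSupport hfc.mul_right

variable {V : Type*} [NormedAddCommGroup V] [NormedSpace ℝ V]

/-- The directional derivative of `f` in the direction `a`. -/
noncomputable def D (a : V) (f : V → ℝ) (p : V) : ℝ := fderiv ℝ f p a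

lemma contDiff_D {f : V → ℝ} (hf : ContDiff ℝ ∞ f) (a : V) : ContDiff ℝ ∞ (D a f) :=
  (hf.fderiv_right (m := ∞) (by simp)).clm_apply contDiff_const

lemma smooth_differentiable {f : V → ℝ} (hf : ContDiff ℝ ∞ f) : Differentiable ℝ f :=
  hf.differentiable (by simp)

lemma hasCompactSupport_D {f : V → ℝ} (hf : HasCompactSupport f) (a : V) :
    HasCompactSupport (D a f) :=
  hf.fderiv_apply ℝ a

lemma tsupport_D_subset (f : V → ℝ) (a : V) : tsupport (D a f) ⊆ tsupport f :=
  tsupport_fderiv_apply_subset ℝ a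

lemma D_eq_zero_of_notMem {f : V → ℝ} {p : V} (hp : p ∉ tsupport f) (a : V) : D a f p = 0 :=
  image_eq_zero_of_notMem_tsupport fun h => hp (tsupport_D_subset f a h)

lemma D_D_eq_zero_of_notMem {f : V → ℝ} {p : V} (hp : p ∉ tsupport f) (a b : V) :
    D a (D b f) p = 0 :=
  D_eq_zero_of_notMem (fun h => hp (tsupport_D_subset f b h)) a

lemma D_add {f g : V → ℝ} (hf : ContDiff ℝ ∞ f) (hg : ContDiff ℝ ∞ g) (a : V) :
    D a (f + g) = D a f + D a g := by
  ext p
  simp [D, fderiv_add (smooth_differentiable hf p) (smooth_differentiable hg p)]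

lemma D_sub {f g : V → ℝ} (hf : ContDiff ℝ ∞ f) (hg : ContDiff ℝ ∞ g) (a : V) :
    D a (f - g) = D a f - D a g := by
  ext p
  simp [D, fderiv_sub (smooth_differentiable hf p) (smooth_differentiable hg p)]

lemma D_D_add {f g : V → ℝ} (hf : ContDiff ℝ ∞ f) (hg : ContDiff ℝ ∞ g) (a b : V) (p : V) :
    D a (D b (f + g)) p = D a (D b f) p + D a (D b g) p := by
  rw [D_add hf hg, D_add (contDiff_D hf b) (contDiff_D hg b), Pi.add_apply]

lemma D_D_sub {f g : V → ℝ} (hf : ContDiff ℝ ∞ f) (hg : ContDiff ℝ ∞ g) (a b : V) (p : V) :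
    D a (D b (f - g)) p = D a (D b f) p - D a (D b g) p := by
  rw [D_sub hf hg, D_sub (contDiff_D hf b) (contDiff_D hg b), Pi.sub_apply]

lemma D_mul {f g : V → ℝ} (hf : ContDiff ℝ ∞ f) (hg : ContDiff ℝ ∞ g) (a : V) (p : V) :
    D a (fun x => f x * g x) p = f p * D a g p + D a f p * g p := by
  simp only [D]
  rw [fderiv_fun_mul (smooth_differentiable hf p) (smooth_differentiable hg p)]
  simp [mul_comm]

lemma D_comm {f : V → ℝ} (hf : ContDiff ℝ ∞ f) (a b : V) : D a (D b f) = D b (D a f) := by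
  ext p
  have h2 : Differentiable ℝ (fderiv ℝ f) :=
    (hf.fderiv_right (m := ∞) (by simp)).differentiable (by simp)
  have key : ∀ c d : V, D c (D d f) p = fderiv ℝ (fderiv ℝ f) p c d := by
    intro c d
    simp only [D]
    change fderiv ℝ (fun x => fderiv ℝ f x d) p c = _
    rw [fderiv_clm_apply (h2 p) (differentiableAt_const d)]
    simp
  rw [key, key]
  exact (hf.contDiffAt.isSymmSndFDerivAt (by
    rw [minSmoothness_of_isRCLikeNormedField]
    exact WithTop.coe_le_coe.2 le_top)) a b

variable [MeasurableSpace V] [BorelSpace V] [FiniteDimensional ℝ V] (μ : Measure V)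
  [μ.IsAddHaarMeasure]

/-- Two directional derivatives can be exchanged under the integral. -/
lemma integral_D_mul_D_comm {f φ : V → ℝ} (hf : ContDiff ℝ ∞ f) (hfc : HasCompactSupport f)
    (hφ : ContDiff ℝ ∞ φ) (a b : V) :
    ∫ x, D a f x * D b φ x ∂μ = ∫ x, D b f x * D a φ x ∂μ := by
  have key : ∀ c d : V, ∫ x, D c f x * D d φ x ∂μ = - ∫ x, f x * D c (D d φ) x ∂μ := by
    intro c d
    have h := integral_mul_fderiv_eq_neg_fderiv_mul_of_integrable (μ := μ) (f := f)
      (g := D d φ) (v := c)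
      (integrable_mul_of_hasCompactSupport μ (contDiff_D hf c).continuous
        (hasCompactSupport_D hfc c) (contDiff_D hφ d).continuous)
      (integrable_mul_of_hasCompactSupport μ hf.continuous hfc
        (contDiff_D (contDiff_D hφ d) c).continuous)
      (integrable_mul_of_hasCompactSupport μ hf.continuous hfc (contDiff_D hφ d).continuous)
      (fun x _ => smooth_differentiable hf x)
      (fun x _ => smooth_differentiable (contDiff_D hφ d) x)
    simp only [D] at h ⊢
    rw [h, neg_neg]
  rw [key, key, D_comm hφ]

/-- The elliptic estimate bounding the velocity by the density. -/
lemma integral_velocity_sq_le {g : V → ℝ} (hg : ContDiff ℝ ∞ g) (hgc : HasCompactSupport g)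
    (a b : V) :
    ∫ x, (D a (D b g) x ^ 2 + D a (D a g) x ^ 2) ∂μ
      ≤ ∫ x, (D a (D a g) x + D b (D b g) x) ^ 2 ∂μ := by
  have sm : ∀ c d : V, ContDiff ℝ ∞ (D c (D d g)) := fun c d => contDiff_D (contDiff_D hg d) c
  have cs : ∀ c d : V, HasCompactSupport (D c (D d g)) :=
    fun c d => hasCompactSupport_D (hasCompactSupport_D hgc d) c
  have int : ∀ c d e f : V, Integrable (fun x => D c (D d g) x * D e (D f g) x) μ :=
    fun c d e f => integrable_mul_of_hasCompactSupport μ (sm c d).continuous (cs c d)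
      (sm e f).continuous
  have h := integral_D_mul_D_comm μ (contDiff_D hg b) (hasCompactSupport_D hgc b)
    (contDiff_D hg a) a b
  rw [D_comm hg b a] at h
  have e1 : ∫ x, (D a (D b g) x ^ 2 + D a (D a g) x ^ 2) ∂μ
      = ∫ x, D a (D b g) x * D a (D b g) x ∂μ + ∫ x, D a (D a g) x * D a (D a g) x ∂μ := by
    rw [← integral_add (int _ _ _ _) (int _ _ _ _)]
    congr 1; ext x; ring
  have e2 : ∫ x, (D a (D a g) x + D b (D b g) x) ^ 2 ∂μ
      = ∫ x, D a (D a g) x * D a (D a g) x ∂μ + 2 * ∫ x, D b (D b g) x * D a (D a g) x ∂μ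
        + ∫ x, D b (D b g) x * D b (D b g) x ∂μ := by
    rw [← integral_const_mul, ← integral_add (int _ _ _ _) ((int _ _ _ _).const_mul 2),
      ← integral_add (by exact (int _ _ _ _).add ((int _ _ _ _).const_mul 2)) (int _ _ _ _)]
    congr 1; ext x; ring
  have nn1 : 0 ≤ ∫ x, D a (D b g) x * D a (D b g) x ∂μ :=
    integral_nonneg fun x => mul_self_nonneg _
  have nn2 : 0 ≤ ∫ x, D b (D b g) x * D b (D b g) x ∂μ :=
    integral_nonneg fun x => mul_self_nonneg _
  rw [e1, e2]
  linarith

end Calculus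

section Waves

variable {V : Type*} [NormedAddCommGroup V] [NormedSpace ℝ V]

lemma contDiff_cos_phase (L : V →L[ℝ] ℝ) (N : ℝ) :
    ContDiff ℝ ∞ fun x => Real.cos (N * L x) :=
  Real.contDiff_cos.comp (contDiff_const.mul L.contDiff)

lemma contDiff_sin_phase (L : V →L[ℝ] ℝ) (N : ℝ) :
    ContDiff ℝ ∞ fun x => Real.sin (N * L x) :=
  Real.contDiff_sin.comp (contDiff_const.mul L.contDiff)

lemma D_cos_phase (L : V →L[ℝ] ℝ) (N : ℝ) (a p : V) :
    D a (fun x => Real.cos (N * L x)) p = -(N * L a * Real.sin (N * L p)) := by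
  have h := ((L.hasFDerivAt (x := p)).const_mul N).cos
  simp only [D, h.fderiv]
  simp
  ring

lemma D_sin_phase (L : V →L[ℝ] ℝ) (N : ℝ) (a p : V) :
    D a (fun x => Real.sin (N * L x)) p = N * L a * Real.cos (N * L p) := by
  have h := ((L.hasFDerivAt (x := p)).const_mul N).sin
  simp only [D, h.fderiv]
  simp
  ring

lemma D_const_mul {f : V → ℝ} (hf : ContDiff ℝ ∞ f) (k : ℝ) (a : V) :
    D a (fun x => k * f x) = fun x => k * D a f x := by
  ext p
  simp [D, fderiv_const_mul (smooth_differentiable hf p)]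

/-- The potential of a localized plane wave oscillating with frequency `N` along `L`. -/
noncomputable def cosWave (χ : V → ℝ) (L : V →L[ℝ] ℝ) (N : ℝ) (x : V) : ℝ :=
  -(1 / N ^ 2) * (χ x * Real.cos (N * L x))

/-- The stream function of a localized plane wave oscillating with frequency `N` along `L`. -/
noncomputable def sinWave (χ : V → ℝ) (L : V →L[ℝ] ℝ) (N : ℝ) (x : V) : ℝ :=
  1 / N * (χ x * Real.sin (N * L x))

variable {χ : V → ℝ}

lemma contDiff_cosWave (hχ : ContDiff ℝ ∞ χ) (L : V →L[ℝ] ℝ) (N : ℝ) :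
    ContDiff ℝ ∞ (cosWave χ L N) :=
  contDiff_const.mul (hχ.mul (contDiff_cos_phase L N))

lemma contDiff_sinWave (hχ : ContDiff ℝ ∞ χ) (L : V →L[ℝ] ℝ) (N : ℝ) :
    ContDiff ℝ ∞ (sinWave χ L N) :=
  contDiff_const.mul (hχ.mul (contDiff_sin_phase L N))

lemma tsupport_cosWave_subset (χ : V → ℝ) (L : V →L[ℝ] ℝ) (N : ℝ) :
    tsupport (cosWave χ L N) ⊆ tsupport χ :=
  closure_mono fun x hx => by
    contrapose! hx
    simp only [Function.mem_support, not_not] at hx ⊢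
    simp [cosWave, hx]

lemma tsupport_sinWave_subset (χ : V → ℝ) (L : V →L[ℝ] ℝ) (N : ℝ) :
    tsupport (sinWave χ L N) ⊆ tsupport χ :=
  closure_mono fun x hx => by
    contrapose! hx
    simp only [Function.mem_support, not_not] at hx ⊢
    simp [sinWave, hx]

lemma D_D_cosWave (hχ : ContDiff ℝ ∞ χ) (L : V →L[ℝ] ℝ) {N : ℝ} (hN : N ≠ 0) (a b p : V) :
    D a (D b (cosWave χ L N)) p = χ p * (L a * L b) * Real.cos (N * L p)
      + 1 / N * ((L b * D a χ p + L a * D b χ p) * Real.sin (N * L p))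
      - 1 / N ^ 2 * (D a (D b χ) p * Real.cos (N * L p)) := by
  have hc := contDiff_cos_phase L N
  have hs := contDiff_sin_phase L N
  have h1 : D b (cosWave χ L N) = (fun x => (1 / N * L b) * (χ x * Real.sin (N * L x)))
      + fun x => -(1 / N ^ 2) * (D b χ x * Real.cos (N * L x)) := by
    ext x
    unfold cosWave
    rw [D_const_mul (hχ.mul hc)]
    simp only [Pi.add_apply]
    rw [D_mul hχ hc, D_cos_phase]
    field_simp
    ring
  rw [h1, D_add (contDiff_const.mul (hχ.mul hs))
    (contDiff_const.mul ((contDiff_D hχ b).mul hc)), Pi.add_apply, D_const_mul (hχ.mul hs),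
    D_const_mul ((contDiff_D hχ b).mul hc)]
  simp only
  rw [D_mul hχ hs, D_mul (contDiff_D hχ b) hc, D_cos_phase, D_sin_phase]
  field_simp
  ring

lemma D_sinWave (hχ : ContDiff ℝ ∞ χ) (L : V →L[ℝ] ℝ) {N : ℝ} (hN : N ≠ 0) (a p : V) :
    D a (sinWave χ L N) p = χ p * L a * Real.cos (N * L p)
      + 1 / N * (D a χ p * Real.sin (N * L p)) := by
  have hs := contDiff_sin_phase L N
  unfold sinWave
  rw [D_const_mul (hχ.mul hs)]
  simp only
  rw [D_mul hχ hs, D_sin_phase]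
  field_simp

lemma exists_bound_D_D_cosWave (hχ : ContDiff ℝ ∞ χ) (hχc : HasCompactSupport χ)
    (L : V →L[ℝ] ℝ) (a b : V) :
    ∃ C : ℝ, 0 ≤ C ∧ ∀ N : ℝ, 1 ≤ N → ∀ p,
      |D a (D b (cosWave χ L N)) p - χ p * (L a * L b) * Real.cos (N * L p)| ≤ C / N := by
  obtain ⟨C1, hC1⟩ := ((contDiff_const (c := L b)).mul (contDiff_D hχ a)).continuous
    |>.bounded_above_of_compact_support (hasCompactSupport_D hχc a).mul_left
  obtain ⟨C2, hC2⟩ := ((contDiff_const (c := L a)).mul (contDiff_D hχ b)).continuous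
    |>.bounded_above_of_compact_support (hasCompactSupport_D hχc b).mul_left
  obtain ⟨C3, hC3⟩ := (contDiff_D (contDiff_D hχ b) a).continuous
    |>.bounded_above_of_compact_support (hasCompactSupport_D (hasCompactSupport_D hχc b) a)
  have n1 := (norm_nonneg _).trans (hC1 0)
  have n2 := (norm_nonneg _).trans (hC2 0)
  have n3 := (norm_nonneg _).trans (hC3 0)
  refine ⟨C1 + C2 + C3, by positivity, fun N hN p => ?_⟩
  have hN0 : (0 : ℝ) < N := by linarith
  rw [D_D_cosWave hχ L hN0.ne']
  have c1 := hC1 p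
  have c2 := hC2 p
  have c3 := hC3 p
  simp only [Real.norm_eq_abs] at c1 c2 c3
  set X := (L b * D a χ p + L a * D b χ p) * Real.sin (N * L p) with hX
  set Y := D a (D b χ) p * Real.cos (N * L p) with hY
  have bX : |X| ≤ C1 + C2 := by
    rw [hX, abs_mul]
    calc _ ≤ |L b * D a χ p + L a * D b χ p| * 1 := by
          gcongr; exact Real.abs_sin_le_one _
      _ ≤ _ := by rw [mul_one]; exact (abs_add_le _ _).trans (add_le_add c1 c2)
  have bY : |Y| ≤ C3 := by
    rw [hY, abs_mul]
    calc _ ≤ |D a (D b χ) p| * 1 := by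
          gcongr; exact Real.abs_cos_le_one _
      _ ≤ _ := by rwa [mul_one]
  have e : ∀ Z : ℝ, Z + 1 / N * X - 1 / N ^ 2 * Y - Z = X / N - Y / N ^ 2 := by
    intro Z; ring
  rw [e]
  calc |X / N - Y / N ^ 2| ≤ |X / N| + |Y / N ^ 2| := abs_sub _ _
    _ = |X| / N + |Y| / N ^ 2 := by
      rw [abs_div, abs_div, abs_of_pos hN0, abs_of_pos (pow_pos hN0 2)]
    _ ≤ (C1 + C2) / N + C3 / N := by
      gcongr
      nlinarith
    _ = (C1 + C2 + C3) / N := by ring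

lemma exists_bound_D_sinWave (hχ : ContDiff ℝ ∞ χ) (hχc : HasCompactSupport χ)
    (L : V →L[ℝ] ℝ) (a : V) :
    ∃ C : ℝ, 0 ≤ C ∧ ∀ N : ℝ, 1 ≤ N → ∀ p,
      |D a (sinWave χ L N) p - χ p * L a * Real.cos (N * L p)| ≤ C / N := by
  obtain ⟨C, hC⟩ := (contDiff_D hχ a).continuous
    |>.bounded_above_of_compact_support (hasCompactSupport_D hχc a)
  refine ⟨C, (norm_nonneg _).trans (hC 0), fun N hN p => ?_⟩
  have hN0 : (0 : ℝ) < N := by linarith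
  rw [D_sinWave hχ L hN0.ne', add_sub_cancel_left, one_div_mul_eq_div, abs_div, abs_of_pos hN0,
    abs_mul]
  have hCp := hC p
  rw [Real.norm_eq_abs] at hCp
  gcongr
  calc _ ≤ |D a χ p| * 1 := by
        gcongr; exact Real.abs_sin_le_one _
    _ ≤ C := by rwa [mul_one]

end Waves

section Hull

/-- The states `(ρ, v₁, v₂, m₁, m₂)` of strict subsolutions. -/
def hull : Set (ℝ × ℝ × ℝ × ℝ × ℝ) :=
  {z | z.1 ^ 2 < 1 ∧
    (z.2.2.2.1 - z.1 * z.2.1) ^ 2 + (z.2.2.2.2 - z.1 * z.2.2.1 + (1 - z.1 ^ 2) / 2) ^ 2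
      < ((1 - z.1 ^ 2) / 2) ^ 2}

lemma isOpen_hull : IsOpen hull := by
  simp only [hull, Set.ofPred_and]
  exact (isOpen_lt (by fun_prop) (by fun_prop)).inter (isOpen_lt (by fun_prop) (by fun_prop))

/-- The wave with wave vector `(ξ₁, ξ₂)`, time frequency `c` and stream amplitude `g`. -/
def waveDir (ξ₁ ξ₂ c g : ℝ) : ℝ × ℝ × ℝ × ℝ × ℝ :=
  (1, ξ₁ * ξ₂, -(ξ₁ * ξ₁), -(c * ξ₁) - g * ξ₂, -(c * ξ₂) + g * ξ₁)

lemma exists_unit_vector (x y : ℝ) :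
    ∃ κ a b : ℝ, 0 ≤ κ ∧ a ^ 2 + b ^ 2 = 1 ∧ x = κ * a ∧ y = κ * b := by
  by_cases h : x ^ 2 + y ^ 2 = 0
  · refine ⟨0, 0, 1, le_rfl, by norm_num, ?_, ?_⟩ <;> nlinarith [sq_nonneg x, sq_nonneg y]
  · have hpos : 0 < x ^ 2 + y ^ 2 := lt_of_le_of_ne (by positivity) (Ne.symm h)
    have hs : 0 < √(x ^ 2 + y ^ 2) := Real.sqrt_pos.2 hpos
    refine ⟨√(x ^ 2 + y ^ 2), x / √(x ^ 2 + y ^ 2), y / √(x ^ 2 + y ^ 2), hs.le, ?_, ?_, ?_⟩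
    · rw [div_pow, div_pow, Real.sq_sqrt hpos.le]; field_simp
    · field_simp
    · field_simp

lemma exists_half_angle {a b : ℝ} (h : a ^ 2 + b ^ 2 = 1) :
    ∃ ξ₁ ξ₂ : ℝ, ξ₁ ^ 2 + ξ₂ ^ 2 = 1 ∧ ξ₁ * ξ₂ = a / 2 ∧ ξ₁ * ξ₁ = (1 - b) / 2 := by
  by_cases hb : b = 1
  · subst hb
    have ha : a = 0 := by nlinarith
    exact ⟨0, 1, by norm_num, by simp [ha], by norm_num⟩
  · have hb1 : b ≤ 1 := by nlinarith [sq_nonneg a]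
    have hpos : 0 < (1 - b) / 2 := by
      have := lt_of_le_of_ne hb1 hb
      linarith
    have hs : 0 < √((1 - b) / 2) := Real.sqrt_pos.2 hpos
    have hsq : √((1 - b) / 2) ^ 2 = (1 - b) / 2 := Real.sq_sqrt hpos.le
    refine ⟨√((1 - b) / 2), a / (2 * √((1 - b) / 2)), ?_, by field_simp, by rw [← sq, hsq]⟩
    rw [div_pow, mul_pow, hsq]
    field_simp
    nlinarith

/-- Through every state of a strict subsolution passes a segment in a wave direction
whose length is comparable to the defect `1 - ρ²`. -/
lemma exists_hull_segment {z : ℝ × ℝ × ℝ × ℝ × ℝ} (hz : z ∈ hull) :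
    ∃ ξ₁ ξ₂ c g : ℝ, ξ₁ ^ 2 + ξ₂ ^ 2 = 1 ∧
      ∀ s : ℝ, |s| ≤ (1 - z.1 ^ 2) / 8 → z + s • waveDir ξ₁ ξ₂ c g ∈ hull := by
  obtain ⟨ρ, v₁, v₂, m₁, m₂⟩ := z
  obtain ⟨h1, h2⟩ := hz
  simp only at h1 h2 ⊢
  obtain ⟨κ, a, b, hκ, hab, hM1, hM2⟩ :=
    exists_unit_vector (m₁ - ρ * v₁) (m₂ - ρ * v₂ + (1 - ρ ^ 2) / 2)
  obtain ⟨ξ₁, ξ₂, hξ, hξa, hξb⟩ := exists_half_angle hab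
  set n₁ := v₁ - ρ * a / 2 with hn₁
  set n₂ := v₂ + ρ * (1 - b) / 2 with hn₂
  refine ⟨ξ₁, ξ₂, -(n₁ * ξ₁ + n₂ * ξ₂), -(n₁ * ξ₂) + n₂ * ξ₁, hξ, fun s hs => ?_⟩
  have d1 : -(-(n₁ * ξ₁ + n₂ * ξ₂) * ξ₁) - (-(n₁ * ξ₂) + n₂ * ξ₁) * ξ₂ = n₁ := by
    linear_combination n₁ * hξ
  have d2 : -(-(n₁ * ξ₁ + n₂ * ξ₂) * ξ₂) + (-(n₁ * ξ₂) + n₂ * ξ₁) * ξ₁ = n₂ := by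
    linear_combination n₂ * hξ
  rw [waveDir, d1, d2, hξa, hξb]
  have hκr : κ < (1 - ρ ^ 2) / 2 := by
    rw [hM1, hM2] at h2
    have : κ ^ 2 < ((1 - ρ ^ 2) / 2) ^ 2 := by
      calc κ ^ 2 = (κ * a) ^ 2 + (κ * b) ^ 2 := by linear_combination (-κ ^ 2) * hab
        _ < _ := h2
    exact lt_of_pow_lt_pow_left₀ 2 (by linarith) this
  have hρ : |ρ| < 1 := by rwa [← sq_lt_one_iff_abs_lt_one]
  have hsρ : |s * ρ| ≤ (1 - ρ ^ 2) / 8 := by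
    rw [abs_mul]
    nlinarith [abs_nonneg s, abs_nonneg ρ]
  have hss : s ^ 2 ≤ (1 - ρ ^ 2) / 8 := by
    rw [← sq_abs]
    nlinarith [abs_nonneg s, sq_nonneg ρ]
  obtain ⟨b1, b2⟩ := abs_le.1 hsρ
  have hs0 := sq_nonneg s
  constructor
  · simp only [Prod.smul_mk, smul_eq_mul, Prod.mk_add_mk]
    have k0 : (ρ + s * 1) ^ 2 = ρ ^ 2 + 2 * (s * ρ) + s ^ 2 := by ring
    linarith
  · simp only [Prod.smul_mk, smul_eq_mul, Prod.mk_add_mk]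
    have k1 : m₁ + s * n₁ - (ρ + s * 1) * (v₁ + s * (a / 2)) = (κ - s * ρ - s ^ 2 / 2) * a := by
      rw [hn₁]; linear_combination hM1
    have k2 : m₂ + s * n₂ - (ρ + s * 1) * (v₂ + s * -((1 - b) / 2)) + (1 - (ρ + s * 1) ^ 2) / 2
        = (κ - s * ρ - s ^ 2 / 2) * b := by
      rw [hn₂]; linear_combination hM2
    rw [k1, k2]
    have k3 : ((κ - s * ρ - s ^ 2 / 2) * a) ^ 2 + ((κ - s * ρ - s ^ 2 / 2) * b) ^ 2
        = (κ - s * ρ - s ^ 2 / 2) ^ 2 := by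
      linear_combination (κ - s * ρ - s ^ 2 / 2) ^ 2 * hab
    have k4 : (1 - (ρ + s * 1) ^ 2) / 2 = (1 - ρ ^ 2) / 2 - s * ρ - s ^ 2 / 2 := by ring
    rw [k3, k4]
    exact sq_lt_sq' (by linarith) (by linarith)

end Hull

/-- Space-time with coordinates `(x₁, x₂, t)`. -/
abbrev E := ℝ × ℝ × ℝ

/-- The `x₁` direction. -/
def e₁ : E := (1, 0, 0)

/-- The `x₂` direction. -/
def e₂ : E := (0, 1, 0)

/-- The time direction. -/
def e₃ : E := (0, 0, 1)

/-- The density `Δθ`. -/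
noncomputable def density (θ : E → ℝ) (p : E) : ℝ := D e₁ (D e₁ θ) p + D e₂ (D e₂ θ) p

/-- The first velocity component `∂₁∂₂θ`. -/
noncomputable def vel₁ (θ : E → ℝ) (p : E) : ℝ := D e₁ (D e₂ θ) p

/-- The second velocity component `-∂₁∂₁θ`. -/
noncomputable def vel₂ (θ : E → ℝ) (p : E) : ℝ := -D e₁ (D e₁ θ) p

/-- The first component of the momentum `-∂ₜ∇θ + ∇^⊥σ`. -/
noncomputable def mom₁ (θ σ : E → ℝ) (p : E) : ℝ := -D e₃ (D e₁ θ) p - D e₂ σ p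

/-- The second component of the momentum `-∂ₜ∇θ + ∇^⊥σ`. -/
noncomputable def mom₂ (θ σ : E → ℝ) (p : E) : ℝ := -D e₃ (D e₂ θ) p + D e₁ σ p

/-- The solution of the linear system with potentials `θ` and `σ`. -/
noncomputable def lin (θ σ : E → ℝ) (p : E) : ℝ × ℝ × ℝ × ℝ × ℝ :=
  (density θ p, vel₁ θ p, vel₂ θ p, mom₁ θ σ p, mom₂ θ σ p)

/-- The constant subsolution from which the construction starts. -/
noncomputable def base : ℝ × ℝ × ℝ × ℝ × ℝ := (0, 0, 0, 0, -1 / 2)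

/-- `θ` and `σ` are test functions supported in `Ω`. -/
structure IsPot (Ω : Set E) (θ σ : E → ℝ) : Prop where
  smooth_θ : ContDiff ℝ ∞ θ
  smooth_σ : ContDiff ℝ ∞ σ
  compact_θ : HasCompactSupport θ
  compact_σ : HasCompactSupport σ
  tsupport_θ : tsupport θ ⊆ Ω
  tsupport_σ : tsupport σ ⊆ Ω

lemma continuous_D_D {θ : E → ℝ} (hθ : ContDiff ℝ ∞ θ) (a b : E) : Continuous (D a (D b θ)) :=
  (contDiff_D (contDiff_D hθ b) a).continuous

lemma continuous_density {θ : E → ℝ} (hθ : ContDiff ℝ ∞ θ) : Continuous (density θ) :=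
  (continuous_D_D hθ _ _).add (continuous_D_D hθ _ _)

lemma continuous_vel₁ {θ : E → ℝ} (hθ : ContDiff ℝ ∞ θ) : Continuous (vel₁ θ) :=
  continuous_D_D hθ _ _

lemma continuous_vel₂ {θ : E → ℝ} (hθ : ContDiff ℝ ∞ θ) : Continuous (vel₂ θ) :=
  (continuous_D_D hθ _ _).neg

lemma continuous_mom₁ {θ σ : E → ℝ} (hθ : ContDiff ℝ ∞ θ) (hσ : ContDiff ℝ ∞ σ) :
    Continuous (mom₁ θ σ) :=
  (continuous_D_D hθ _ _).neg.sub (contDiff_D hσ _).continuous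

lemma continuous_mom₂ {θ σ : E → ℝ} (hθ : ContDiff ℝ ∞ θ) (hσ : ContDiff ℝ ∞ σ) :
    Continuous (mom₂ θ σ) :=
  (continuous_D_D hθ _ _).neg.add (contDiff_D hσ _).continuous

lemma continuous_lin {θ σ : E → ℝ} (hθ : ContDiff ℝ ∞ θ) (hσ : ContDiff ℝ ∞ σ) :
    Continuous (lin θ σ) :=
  (continuous_density hθ).prodMk ((continuous_vel₁ hθ).prodMk ((continuous_vel₂ hθ).prodMk
    ((continuous_mom₁ hθ hσ).prodMk (continuous_mom₂ hθ hσ))))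

lemma density_eq_zero {θ : E → ℝ} {p : E} (hp : p ∉ tsupport θ) : density θ p = 0 := by
  simp [density, D_D_eq_zero_of_notMem hp]

lemma lin_eq_zero {θ σ : E → ℝ} {p : E} (hθ : p ∉ tsupport θ) (hσ : p ∉ tsupport σ) :
    lin θ σ p = 0 := by
  simp [lin, density, vel₁, vel₂, mom₁, mom₂, D_D_eq_zero_of_notMem hθ, D_eq_zero_of_notMem hσ]

lemma density_add {θ θ' : E → ℝ} (hθ : ContDiff ℝ ∞ θ) (hθ' : ContDiff ℝ ∞ θ') (p : E) :
    density (θ + θ') p = density θ p + density θ' p := by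
  simp only [density, D_D_add hθ hθ']
  ring

lemma lin_add {θ θ' σ σ' : E → ℝ} (hθ : ContDiff ℝ ∞ θ) (hθ' : ContDiff ℝ ∞ θ')
    (hσ : ContDiff ℝ ∞ σ) (hσ' : ContDiff ℝ ∞ σ') (p : E) :
    lin (θ + θ') (σ + σ') p = lin θ σ p + lin θ' σ' p := by
  simp only [lin, density, vel₁, vel₂, mom₁, mom₂, D_D_add hθ hθ', D_add hσ hσ', Pi.add_apply,
    Prod.mk_add_mk, Prod.mk.injEq]
  exact ⟨by ring, trivial, by ring, by ring, by ring⟩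

lemma IsPot.add {Ω : Set E} {θ θ' σ σ' : E → ℝ} (h : IsPot Ω θ σ) (h' : IsPot Ω θ' σ') :
    IsPot Ω (θ + θ') (σ + σ') where
  smooth_θ := h.smooth_θ.add h'.smooth_θ
  smooth_σ := h.smooth_σ.add h'.smooth_σ
  compact_θ := h.compact_θ.add h'.compact_θ
  compact_σ := h.compact_σ.add h'.compact_σ
  tsupport_θ := (tsupport_add _ _).trans (Set.union_subset h.tsupport_θ h'.tsupport_θ)
  tsupport_σ := (tsupport_add _ _).trans (Set.union_subset h.tsupport_σ h'.tsupport_σ)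

lemma IsPot.mono {Ω Ω' : Set E} {θ σ : E → ℝ} (h : IsPot Ω θ σ) (hΩ : Ω ⊆ Ω') :
    IsPot Ω' θ σ :=
  { h with
    tsupport_θ := h.tsupport_θ.trans hΩ
    tsupport_σ := h.tsupport_σ.trans hΩ }

lemma isPot_zero (Ω : Set E) : IsPot Ω 0 0 where
  smooth_θ := contDiff_const
  smooth_σ := contDiff_const
  compact_θ := HasCompactSupport.zero
  compact_σ := HasCompactSupport.zero
  tsupport_θ := by simp [tsupport]
  tsupport_σ := by simp [tsupport]

lemma hasCompactSupport_density {θ : E → ℝ} (h : HasCompactSupport θ) :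
    HasCompactSupport (density θ) :=
  (hasCompactSupport_D (hasCompactSupport_D h _) _).add
    (hasCompactSupport_D (hasCompactSupport_D h _) _)

instance isAddHaarMeasure_volume_plane : (volume : Measure (ℝ × ℝ)).IsAddHaarMeasure :=
  Measure.prod.instIsAddHaarMeasure volume volume

instance isAddHaarMeasure_volume : (volume : Measure E).IsAddHaarMeasure :=
  Measure.prod.instIsAddHaarMeasure volume volume

/-- The Riemann-Lebesgue lemma for real oscillating integrals. -/
lemma tendsto_integral_mul_cos {L : E →L[ℝ] ℝ} (hL : L ≠ 0) {f : E → ℝ} (hf : Integrable f) :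
    Tendsto (fun N : ℝ => ∫ p, f p * Real.cos (N * L p)) atTop (𝓝 0) := by
  have h := tendsto_integral_exp_smul_cocompact (fun p => (f p : ℂ)) (volume : Measure E)
  have hw : Tendsto (fun N : ℝ => (-(N / (2 * Real.pi))) • L) atTop
      (cocompact (StrongDual ℝ E)) := by
    rw [← Metric.cobounded_eq_cocompact, ← tendsto_norm_atTop_iff_cobounded]
    have : ∀ N : ℝ, ‖(-(N / (2 * Real.pi))) • L‖ = |N| * (‖L‖ / (2 * Real.pi)) := by
      intro N
      rw [norm_smul, norm_neg, norm_div, Real.norm_eq_abs, Real.norm_of_nonneg (by positivity)]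
      ring
    simp only [this]
    exact tendsto_abs_atTop_atTop.atTop_mul_const
      (div_pos (norm_pos_iff.2 hL) (by positivity))
  have h2 := (Complex.continuous_re.tendsto 0).comp (h.comp hw)
  rw [Complex.zero_re] at h2
  refine h2.congr fun N => ?_
  simp only [Function.comp_apply]
  have key : ∀ p : E, ((Real.fourierChar (-((-(N / (2 * Real.pi))) • L) p)) • (f p : ℂ))
      = Complex.exp ((N * L p : ℝ) * Complex.I) * (f p : ℂ) := by
    intro p
    rw [Circle.smul_def, Real.fourierChar_apply, smul_eq_mul]
    congr 3
    simp only [_root_.smul_apply, smul_eq_mul, neg_mul, neg_neg]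
    norm_cast
    field_simp
  simp only [key]
  have hint : Integrable fun p => Complex.exp ((N * L p : ℝ) * Complex.I) * (f p : ℂ) := by
    refine hf.ofReal.bdd_mul (c := 1) (Continuous.aestronglyMeasurable (by fun_prop)) ?_
    exact Eventually.of_forall fun p => (Complex.norm_exp_ofReal_mul_I _).le
  have := integral_re hint
  simp only [RCLike.re_eq_complex_re] at this
  rw [← this]
  congr 1
  ext p
  rw [Complex.mul_re, Complex.exp_ofReal_mul_I_re, Complex.ofReal_re, Complex.ofReal_im]
  ring

/-- The phase `ξ₁ x₁ + ξ₂ x₂ + c t`. -/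
noncomputable def phase (ξ₁ ξ₂ c : ℝ) : E →L[ℝ] ℝ :=
  ξ₁ • ContinuousLinearMap.fst ℝ ℝ (ℝ × ℝ)
    + (ξ₂ • (ContinuousLinearMap.fst ℝ ℝ ℝ) + c • (ContinuousLinearMap.snd ℝ ℝ ℝ)).comp
      (ContinuousLinearMap.snd ℝ ℝ (ℝ × ℝ))

lemma phase_e₁ (ξ₁ ξ₂ c : ℝ) : phase ξ₁ ξ₂ c e₁ = ξ₁ := by simp [phase, e₁]

lemma phase_e₂ (ξ₁ ξ₂ c : ℝ) : phase ξ₁ ξ₂ c e₂ = ξ₂ := by simp [phase, e₂]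

lemma phase_e₃ (ξ₁ ξ₂ c : ℝ) : phase ξ₁ ξ₂ c e₃ = c := by simp [phase, e₃]

lemma phase_ne_zero {ξ₁ ξ₂ : ℝ} (h : ξ₁ ^ 2 + ξ₂ ^ 2 = 1) (c : ℝ) : phase ξ₁ ξ₂ c ≠ 0 := by
  intro h0
  have h1 := phase_e₁ ξ₁ ξ₂ c
  have h2 := phase_e₂ ξ₁ ξ₂ c
  simp only [h0, _root_.zero_apply] at h1 h2
  subst h1 h2
  norm_num at h

/-- Localized plane waves solve the linear system up to an error `O(1 / N)`. -/
lemma exists_bound_lin_wave {χ : E → ℝ} (hχ : ContDiff ℝ ∞ χ) (hχc : HasCompactSupport χ)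
    {ξ₁ ξ₂ : ℝ} (hξ : ξ₁ ^ 2 + ξ₂ ^ 2 = 1) (c g : ℝ) :
    ∃ C : ℝ, 0 ≤ C ∧ ∀ N : ℝ, 1 ≤ N → ∀ p,
      ‖lin (cosWave χ (phase ξ₁ ξ₂ c) N) (fun x => g * sinWave χ (phase ξ₁ ξ₂ c) N x) p
        - (χ p * Real.cos (N * phase ξ₁ ξ₂ c p)) • waveDir ξ₁ ξ₂ c g‖ ≤ C / N := by
  obtain ⟨C11, n11, h11⟩ := exists_bound_D_D_cosWave hχ hχc (phase ξ₁ ξ₂ c) e₁ e₁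
  obtain ⟨C12, n12, h12⟩ := exists_bound_D_D_cosWave hχ hχc (phase ξ₁ ξ₂ c) e₁ e₂
  obtain ⟨C22, n22, h22⟩ := exists_bound_D_D_cosWave hχ hχc (phase ξ₁ ξ₂ c) e₂ e₂
  obtain ⟨C31, n31, h31⟩ := exists_bound_D_D_cosWave hχ hχc (phase ξ₁ ξ₂ c) e₃ e₁
  obtain ⟨C32, n32, h32⟩ := exists_bound_D_D_cosWave hχ hχc (phase ξ₁ ξ₂ c) e₃ e₂
  obtain ⟨C1, n1, h1⟩ := exists_bound_D_sinWave hχ hχc (phase ξ₁ ξ₂ c) e₁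
  obtain ⟨C2, n2, h2⟩ := exists_bound_D_sinWave hχ hχc (phase ξ₁ ξ₂ c) e₂
  refine ⟨C11 + C12 + C22 + C31 + C32 + |g| * C1 + |g| * C2, by positivity, fun N hN p => ?_⟩
  have hN0 : (0 : ℝ) < N := by linarith
  have k11 := h11 N hN p
  have k12 := h12 N hN p
  have k22 := h22 N hN p
  have k31 := h31 N hN p
  have k32 := h32 N hN p
  have k1 := h1 N hN p
  have k2 := h2 N hN p
  have cs : ContDiff ℝ ∞ (sinWave χ (phase ξ₁ ξ₂ c) N) := contDiff_sinWave hχ _ _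
  simp only [phase_e₁, phase_e₂, phase_e₃] at k11 k12 k22 k31 k32 k1 k2
  simp only [lin, density, vel₁, vel₂, mom₁, mom₂, waveDir, D_const_mul cs, Prod.smul_mk,
    smul_eq_mul, Prod.mk_sub_mk, norm_prod_le_iff, Real.norm_eq_abs]
  simp only [add_div, mul_div_assoc]
  set q := Real.cos (N * phase ξ₁ ξ₂ c p)
  have m11 : 0 ≤ C11 / N := by positivity
  have m12 : 0 ≤ C12 / N := by positivity
  have m22 : 0 ≤ C22 / N := by positivity
  have m31 : 0 ≤ C31 / N := by positivity
  have m32 : 0 ≤ C32 / N := by positivity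
  have m1 : 0 ≤ |g| * (C1 / N) := by positivity
  have m2 : 0 ≤ |g| * (C2 / N) := by positivity
  have g1 := mul_le_mul_of_nonneg_left k1 (abs_nonneg g)
  have g2 := mul_le_mul_of_nonneg_left k2 (abs_nonneg g)
  rw [← abs_mul, abs_le] at g1 g2
  rw [abs_le] at k11 k12 k22 k31 k32
  simp only [abs_le]
  have hq : χ p * q * 1 = χ p * (ξ₁ * ξ₁) * q + χ p * (ξ₂ * ξ₂) * q := by
    linear_combination (-(χ p * q)) * hξ
  refine ⟨⟨?_, ?_⟩, ⟨?_, ?_⟩, ⟨?_, ?_⟩, ⟨?_, ?_⟩, ⟨?_, ?_⟩⟩ <;> linarith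

lemma measureReal_closedBall_half (x : E) {r : ℝ} (hr : 0 < r) :
    volume.real (closedBall x r) = 8 * volume.real (closedBall x (r / 2)) := by
  rw [Measure.real, Measure.real, Measure.addHaar_closedBall _ _ hr.le,
    Measure.addHaar_closedBall _ _ (half_pos hr).le, ENNReal.toReal_mul, ENNReal.toReal_mul,
    ENNReal.toReal_ofReal (by positivity), ENNReal.toReal_ofReal (by positivity)]
  have : Module.finrank ℝ E = 3 := by simp
  rw [this]
  ring

/-- If `ρ` is uniformly close to `χ cos (N L)`, with `χ` supported in a ball on the half of which
it equals `s`, then for large frequencies `N` the square integral of `ρ` is bounded below. -/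
lemma eventually_le_integral_sq {x₀ : E} {r s : ℝ} (hr : 0 < r) (hs : 0 < s) {χ : E → ℝ}
    (hχ : Continuous χ) (hχc : HasCompactSupport χ) (hχs : ∀ p, |χ p| ≤ s)
    (hχ1 : ∀ p ∈ closedBall x₀ (r / 2), χ p = s) (hχ0 : ∀ p, p ∉ closedBall x₀ r → χ p = 0)
    {L : E →L[ℝ] ℝ} (hL : L ≠ 0) {ρ : ℝ → E → ℝ} (hρ : ∀ N, Continuous (ρ N))
    (hρ0 : ∀ N, ∀ p, p ∉ closedBall x₀ r → ρ N p = 0) {C : ℝ}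
    (hρχ : ∀ N : ℝ, 1 ≤ N → ∀ p, |ρ N p - χ p * Real.cos (N * L p)| ≤ C / N) :
    ∀ᶠ N in atTop, s ^ 2 / 4 * volume.real (closedBall x₀ (r / 2)) ≤ ∫ p, ρ N p ^ 2 := by
  set B := closedBall x₀ r
  set B' := closedBall x₀ (r / 2)
  have hB : volume B ≠ ⊤ := measure_closedBall_lt_top.ne
  have hB' : volume B' ≠ ⊤ := measure_closedBall_lt_top.ne
  have cχ2 : Integrable fun p => χ p * χ p := integrable_mul_of_hasCompactSupport _ hχ hχc hχ
  have hpos : 0 < volume.real B' :=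
    ENNReal.toReal_pos (measure_closedBall_pos _ _ (half_pos hr)).ne' hB'
  have lowχ : s ^ 2 * volume.real B' ≤ ∫ p, χ p * χ p := by
    have h1 : ∫ p in B', s ^ 2 = s ^ 2 * volume.real B' := by
      rw [setIntegral_const, smul_eq_mul, mul_comm]
    rw [← h1]
    calc ∫ p in B', s ^ 2 = ∫ p in B', χ p * χ p :=
          setIntegral_congr_fun measurableSet_closedBall fun p hp => by
            simp only [hχ1 p hp]; ring
      _ ≤ ∫ p, χ p * χ p := setIntegral_le_integral cχ2
          (Eventually.of_forall fun p => mul_self_nonneg _)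
  have lim : Tendsto (fun N : ℝ => 1 / 2 * ∫ p, χ p * χ p) atTop
      (𝓝 (1 / 2 * ∫ p, χ p * χ p)) := tendsto_const_nhds
  have lim2 : Tendsto (fun N : ℝ => 1 / 2 * ∫ p, χ p * χ p * Real.cos (2 * N * L p)) atTop
      (𝓝 (1 / 2 * 0)) :=
    ((tendsto_integral_mul_cos hL cχ2).comp
      (tendsto_id.const_mul_atTop (zero_lt_two' ℝ))).const_mul _
  have lim3 : Tendsto (fun N : ℝ => 2 * s * volume.real B * C / N) atTop (𝓝 0) :=
    tendsto_const_nhds.div_atTop tendsto_id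
  have limit := (lim.add lim2).sub lim3
  have hlt : s ^ 2 / 4 * volume.real B' < 1 / 2 * (∫ p, χ p * χ p) + 1 / 2 * 0 - 0 := by
    have : 0 < s ^ 2 * volume.real B' := by positivity
    linarith
  filter_upwards [limit.eventually (lt_mem_nhds hlt), eventually_ge_atTop (1 : ℝ)] with N hN hN1
  refine hN.le.trans ?_
  have hN0 : (0 : ℝ) < N := by linarith
  have icos : Integrable fun p => χ p * χ p * Real.cos (2 * N * L p) :=
    cχ2.mul_bdd (c := 1) (Continuous.aestronglyMeasurable (by fun_prop))
      (Eventually.of_forall fun p => Real.abs_cos_le_one _)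
  have iind : Integrable (B.indicator fun _ : E => 2 * s * (C / N)) :=
    (integrableOn_const hB).integrable_indicator measurableSet_closedBall
  have eind : ∫ p, B.indicator (fun _ : E => 2 * s * (C / N)) p
      = 2 * s * volume.real B * C / N := by
    rw [integral_indicator measurableSet_closedBall, setIntegral_const, smul_eq_mul]
    ring
  have isum : Integrable fun p => 1 / 2 * (χ p * χ p)
      + 1 / 2 * (χ p * χ p * Real.cos (2 * N * L p)) :=
    (cχ2.const_mul _).add (icos.const_mul _)
  have iρ : Integrable fun p => ρ N p ^ 2 := by
    refine ((hρ N).pow 2).integrable_of_hasCompactSupport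
      (HasCompactSupport.intro (isCompact_closedBall x₀ r) fun p hp => ?_)
    rw [Pi.pow_apply, hρ0 N p hp]; ring
  rw [← eind, ← integral_const_mul, ← integral_const_mul,
    ← integral_add (cχ2.const_mul _) (icos.const_mul _), ← integral_sub isum iind]
  refine integral_mono (isum.sub iind) iρ fun p => ?_
  simp only
  by_cases hp : p ∈ B
  · rw [Set.indicator_of_mem hp, mul_assoc 2 N, Real.cos_two_mul]
    have h1 := hρχ N hN1 p
    set A := χ p * Real.cos (N * L p) with hA
    have h2 : |A| ≤ s := by
      rw [hA, abs_mul]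
      calc _ ≤ |χ p| * 1 := by gcongr; exact Real.abs_cos_le_one _
        _ ≤ s := by rw [mul_one]; exact hχs p
    have h3 : |A * (ρ N p - A)| ≤ s * (C / N) := by
      rw [abs_mul]; gcongr
    have h4 := (abs_le.1 h3).1
    have h5 : 1 / 2 * (χ p * χ p) + 1 / 2 * (χ p * χ p * (2 * Real.cos (N * L p) ^ 2 - 1))
        = A ^ 2 := by rw [hA]; ring
    rw [h5]
    nlinarith [sq_nonneg (ρ N p - A)]
  · rw [Set.indicator_of_notMem hp, hχ0 p hp]
    nlinarith [sq_nonneg (ρ N p)]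

/-- Functions uniformly close to `χ cos (N L)` are nearly orthogonal to any fixed integrable
function for large frequencies `N`. -/
lemma tendsto_integral_mul_zero {χ : E → ℝ} (hχ : Continuous χ) {s : ℝ} (hχs : ∀ p, |χ p| ≤ s)
    {L : E →L[ℝ] ℝ} (hL : L ≠ 0) {ρ : ℝ → E → ℝ} (hρ : ∀ N, Continuous (ρ N)) {C : ℝ}
    (hρχ : ∀ N : ℝ, 1 ≤ N → ∀ p, |ρ N p - χ p * Real.cos (N * L p)| ≤ C / N)
    {f : E → ℝ} (hf : Integrable f) :
    Tendsto (fun N => ∫ p, ρ N p * f p) atTop (𝓝 0) := by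
  have iχf : Integrable fun p => χ p * f p :=
    hf.bdd_mul (c := s) hχ.aestronglyMeasurable (Eventually.of_forall hχs)
  have lim1 := tendsto_integral_mul_cos hL iχf
  have lim2 : Tendsto (fun N : ℝ => ∫ p, (ρ N p - χ p * Real.cos (N * L p)) * f p) atTop
      (𝓝 0) := by
    have b : Tendsto (fun N : ℝ => (C * ∫ p, |f p|) / N) atTop (𝓝 0) :=
      tendsto_const_nhds.div_atTop tendsto_id
    refine squeeze_zero_norm' ?_ b
    filter_upwards [eventually_ge_atTop (1 : ℝ)] with N hN
    calc ‖∫ p, (ρ N p - χ p * Real.cos (N * L p)) * f p‖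
        ≤ ∫ p, C / N * |f p| := by
          refine norm_integral_le_of_norm_le (hf.abs.const_mul _)
            (Eventually.of_forall fun p => ?_)
          rw [norm_mul, Real.norm_eq_abs, Real.norm_eq_abs]
          exact mul_le_mul_of_nonneg_right (hρχ N hN p) (abs_nonneg _)
      _ = (C * ∫ p, |f p|) / N := by rw [integral_const_mul]; ring
  have lim := lim1.add lim2
  rw [add_zero] at lim
  refine lim.congr' ?_
  filter_upwards [eventually_ge_atTop (1 : ℝ)] with N hN
  have i1 : Integrable fun p => χ p * f p * Real.cos (N * L p) :=
    iχf.mul_bdd (c := 1) (Continuous.aestronglyMeasurable (by fun_prop))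
      (Eventually.of_forall fun p => Real.abs_cos_le_one _)
  have i2 : Integrable fun p => (ρ N p - χ p * Real.cos (N * L p)) * f p := by
    refine hf.bdd_mul (c := C / N) (Continuous.aestronglyMeasurable ?_)
      (Eventually.of_forall fun p => hρχ N hN p)
    have := hρ N
    fun_prop
  rw [← integral_add i1 i2]
  congr 1
  ext p
  ring

/-- Around every point, a strict subsolution can be perturbed by localized waves on small balls,
weakly close to zero, with an `L²` norm comparable to the local defect. -/
lemma exists_local_perturbation {θ σ : E → ℝ} (hθ : ContDiff ℝ ∞ θ) (hσ : ContDiff ℝ ∞ σ)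
    (x₀ : E) (hz : base + lin θ σ x₀ ∈ hull) :
    ∃ R > 0, ∀ r, 0 < r → r < R → ∀ F : List (E → ℝ), (∀ f ∈ F, Integrable f) → ∀ ε > 0,
      ∃ θ' σ' : E → ℝ, IsPot (closedBall x₀ r) θ' σ' ∧
        (∀ p ∈ closedBall x₀ r, base + lin θ σ p + lin θ' σ' p ∈ hull) ∧
        (∀ f ∈ F, |∫ p, density θ' p * f p| ≤ ε) ∧
        1 / 8192 * ∫ p in closedBall x₀ r, (1 - density θ p ^ 2) ^ 2 ≤ ∫ p, density θ' p ^ 2 := by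
  obtain ⟨ξ₁, ξ₂, c, g, hξ, hseg⟩ := exists_hull_segment hz
  have hz1 : (base + lin θ σ x₀).1 = density θ x₀ := by simp [base, lin]
  have hlt : density θ x₀ ^ 2 < 1 := by rw [← hz1]; exact hz.1
  rw [hz1] at hseg
  set s := (1 - density θ x₀ ^ 2) / 8 with hs
  have hs0 : 0 < s := by rw [hs]; linarith
  set w := waveDir ξ₁ ξ₂ c g
  set L := phase ξ₁ ξ₂ c
  have hL : L ≠ 0 := phase_ne_zero hξ c
  have hK : IsCompact ((fun t : ℝ => base + lin θ σ x₀ + t • w) '' Set.Icc (-s) s) :=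
    isCompact_Icc.image (by fun_prop)
  obtain ⟨δ, hδ, hthick⟩ := hK.exists_thickening_subset_open isOpen_hull (by
    rintro _ ⟨t, ht, rfl⟩
    exact hseg t (abs_le.2 ht))
  have cl : Continuous fun p => base + lin θ σ p := continuous_const.add (continuous_lin hθ hσ)
  have cd := continuous_density hθ
  have ev1 : ∀ᶠ p in 𝓝 x₀, dist (base + lin θ σ p) (base + lin θ σ x₀) < δ / 2 :=
    cl.continuousAt.eventually (ball_mem_nhds _ (half_pos hδ))
  have ev2 : ∀ᶠ p in 𝓝 x₀, 1 - density θ p ^ 2 < 2 * (8 * s) := by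
    have : Continuous fun p => 1 - density θ p ^ 2 := by fun_prop
    refine this.continuousAt.eventually (gt_mem_nhds ?_)
    rw [hs]; linarith
  have ev3 : ∀ᶠ p in 𝓝 x₀, density θ p ^ 2 < 1 := by
    have : Continuous fun p => density θ p ^ 2 := by fun_prop
    exact this.continuousAt.eventually (gt_mem_nhds hlt)
  obtain ⟨R, hR, hRs⟩ := Metric.eventually_nhds_iff_ball.1 (ev1.and (ev2.and ev3))
  refine ⟨R, hR, fun r hr hrR F hF ε hε => ?_⟩
  have hB : ∀ p ∈ closedBall x₀ r, p ∈ ball x₀ R := fun p hp =>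
    closedBall_subset_ball hrR hp
  let b : ContDiffBump x₀ := ⟨r / 2, r, half_pos hr, half_lt_self hr⟩
  let χ : E → ℝ := fun p => s * b p
  have hχ : ContDiff ℝ ∞ χ := contDiff_const.mul b.contDiff
  have tχ : tsupport χ ⊆ closedBall x₀ r := by
    have h1 : tsupport χ ⊆ tsupport b := tsupport_mul_subset_right
    exact h1.trans b.tsupport_eq.subset
  have hχc : HasCompactSupport χ := (isCompact_closedBall x₀ r).of_isClosed_subset
    (isClosed_tsupport _) tχ
  have hχs : ∀ p, |χ p| ≤ s := fun p => by
    rw [abs_of_nonneg (mul_nonneg hs0.le b.nonneg)]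
    exact mul_le_of_le_one_right hs0.le b.le_one
  have hχ1 : ∀ p ∈ closedBall x₀ (r / 2), χ p = s := fun p hp => by
    simp only [χ, b.one_of_mem_closedBall hp, mul_one]
  have hχ0 : ∀ p, p ∉ closedBall x₀ r → χ p = 0 := fun p hp =>
    image_eq_zero_of_notMem_tsupport fun h => hp (tχ h)
  obtain ⟨C, hC, hCb⟩ := exists_bound_lin_wave hχ hχc hξ c g
  let θ' : ℝ → E → ℝ := fun N => cosWave χ L N
  let σ' : ℝ → E → ℝ := fun N x => g * sinWave χ L N x
  have pot : ∀ N, IsPot (closedBall x₀ r) (θ' N) (σ' N) := by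
    intro N
    have t1 : tsupport (θ' N) ⊆ closedBall x₀ r := (tsupport_cosWave_subset _ _ _).trans tχ
    have t2 : tsupport (σ' N) ⊆ closedBall x₀ r :=
      tsupport_mul_subset_right.trans
        ((tsupport_sinWave_subset _ _ _).trans tχ)
    exact ⟨contDiff_cosWave hχ _ _, contDiff_const.mul (contDiff_sinWave hχ _ _),
      (isCompact_closedBall x₀ r).of_isClosed_subset (isClosed_tsupport _) t1,
      (isCompact_closedBall x₀ r).of_isClosed_subset (isClosed_tsupport _) t2, t1, t2⟩
  have hρ : ∀ N, Continuous (density (θ' N)) := fun N => continuous_density (pot N).smooth_θ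
  have hρ0 : ∀ N, ∀ p, p ∉ closedBall x₀ r → density (θ' N) p = 0 := fun N p hp =>
    density_eq_zero fun h => hp ((pot N).tsupport_θ h)
  have hρχ : ∀ N : ℝ, 1 ≤ N → ∀ p, |density (θ' N) p - χ p * Real.cos (N * L p)| ≤ C / N := by
    intro N hN p
    have := (norm_fst_le _).trans (hCb N hN p)
    simpa [lin, waveDir, w] using this
  have E1 := eventually_le_integral_sq hr hs0 hχ.continuous hχc hχs hχ1 hχ0 hL hρ hρ0 hρχ
  have E2 : ∀ᶠ N in atTop, ∀ f ∈ F, |∫ p, density (θ' N) p * f p| ≤ ε := by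
    refine (eventually_all_finite F.finite_toSet).2 fun f hf => ?_
    have h := (tendsto_integral_mul_zero hχ.continuous hχs hL hρ hρχ (hF f hf)).norm
    rw [norm_zero] at h
    exact h.eventually (ge_mem_nhds hε)
  have E3 : ∀ᶠ N : ℝ in atTop, C / N < δ / 2 :=
    (tendsto_const_nhds.div_atTop tendsto_id).eventually (gt_mem_nhds (half_pos hδ))
  obtain ⟨N, h1, h2, h3, hN⟩ := (E1.and (E2.and (E3.and (eventually_ge_atTop (1 : ℝ))))).exists
  refine ⟨θ' N, σ' N, pot N, fun p hp => ?_, h2, ?_⟩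
  · apply hthick
    rw [mem_thickening_iff]
    refine ⟨_, ⟨χ p * Real.cos (N * L p), ?_, rfl⟩, ?_⟩
    · rw [Set.mem_Icc, ← abs_le, abs_mul]
      calc _ ≤ |χ p| * 1 := by gcongr; exact Real.abs_cos_le_one _
        _ ≤ s := by rw [mul_one]; exact hχs p
    · refine (dist_add_add_le _ _ _ _).trans_lt ?_
      have k1 := (hRs p (hB p hp)).1
      have k2 := hCb N hN p
      rw [← dist_eq_norm] at k2
      change dist _ _ + dist (lin (θ' N) (σ' N) p) ((χ p * Real.cos (N * L p)) • w) < δ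
      have k3 : dist (lin (θ' N) (σ' N) p) ((χ p * Real.cos (N * L p)) • w) ≤ C / N := k2
      linarith
  · refine le_trans ?_ h1
    have hbd : ∫ p in closedBall x₀ r, (1 - density θ p ^ 2) ^ 2
        ≤ ∫ p in closedBall x₀ r, (16 * s) ^ 2 := by
      refine setIntegral_mono_on ?_ ?_ measurableSet_closedBall fun p hp => ?_
      · exact (Continuous.continuousOn (by fun_prop)).integrableOn_compact
          (isCompact_closedBall _ _)
      · exact integrableOn_const measure_closedBall_lt_top.ne
      · obtain ⟨-, k2, k3⟩ := hRs p (hB p hp)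
        exact pow_le_pow_left₀ (by linarith) (by linarith) 2
    rw [setIntegral_const, smul_eq_mul, measureReal_closedBall_half x₀ hr] at hbd
    linarith

lemma integrable_density_sq {Ω : Set E} {θ σ : E → ℝ} (h : IsPot Ω θ σ) :
    Integrable fun p => density θ p ^ 2 := by
  simpa only [sq] using integrable_mul_of_hasCompactSupport volume
    (continuous_density h.smooth_θ) (hasCompactSupport_density h.compact_θ)
    (continuous_density h.smooth_θ)

lemma integrable_density_mul {Ω : Set E} {θ σ : E → ℝ} (h : IsPot Ω θ σ) {f : E → ℝ}
    (hf : Integrable f) : Integrable fun p => density θ p * f p := by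
  obtain ⟨C, hC⟩ := (hasCompactSupport_density h.compact_θ).exists_bound_of_continuous
    (continuous_density h.smooth_θ)
  exact hf.bdd_mul (c := C) (continuous_density h.smooth_θ).aestronglyMeasurable
    (Eventually.of_forall hC)

lemma exists_sum_perturbation {ι : Type*} {θ σ : E → ℝ} {F : List (E → ℝ)}
    (hF : ∀ f ∈ F, Integrable f) (hz : ∀ p, base + lin θ σ p ∈ hull) {ε : ℝ} (hε : 0 < ε)
    (B : ι → Set E) (c : ι → ℝ) (S : Finset ι)
    (hd : (S : Set ι).PairwiseDisjoint B)
    (hloc : ∀ i ∈ S, ∀ ε > 0, ∃ θ' σ' : E → ℝ, IsPot (B i) θ' σ' ∧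
        (∀ p ∈ B i, base + lin θ σ p + lin θ' σ' p ∈ hull) ∧
        (∀ f ∈ F, |∫ p, density θ' p * f p| ≤ ε) ∧ c i ≤ ∫ p, density θ' p ^ 2) :
    ∃ θ' σ' : E → ℝ, IsPot (⋃ i ∈ S, B i) θ' σ' ∧
        (∀ p, base + lin θ σ p + lin θ' σ' p ∈ hull) ∧
        (∀ f ∈ F, |∫ p, density θ' p * f p| ≤ ε) ∧
        ∑ i ∈ S, c i ≤ ∫ p, density θ' p ^ 2 := by
  classical
  induction S using Finset.induction_on generalizing ε with
  | empty =>
    have h0 : ∀ p, density 0 p = 0 := fun p => density_eq_zero (by simp [tsupport])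
    refine ⟨0, 0, isPot_zero _, fun p => ?_, fun f _ => ?_, ?_⟩
    · rw [lin_eq_zero (θ := 0) (σ := 0) (by simp [tsupport]) (by simp [tsupport]), add_zero]
      exact hz p
    · simp [h0, hε.le]
    · simp [h0]
  | insert a S ha ih =>
    obtain ⟨θ₁, σ₁, pot₁, hull₁, small₁, large₁⟩ := ih (half_pos hε)
      (hd.subset (by simp)) (fun i hi => hloc i (Finset.mem_insert_of_mem hi))
    obtain ⟨θ₂, σ₂, pot₂, hull₂, small₂, large₂⟩ :=
      hloc a (Finset.mem_insert_self _ _) _ (half_pos hε)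
    have disj : ∀ p ∈ B a, p ∉ ⋃ i ∈ S, B i := by
      intro p hp hp'
      simp only [Set.mem_iUnion] at hp'
      obtain ⟨i, hi, hpi⟩ := hp'
      have hne : a ≠ i := fun h => ha (h ▸ hi)
      exact Set.disjoint_left.1 (hd (by simp) (by simp [hi]) hne) hp hpi
    have z₁ : ∀ p ∈ B a, p ∉ tsupport θ₁ ∧ p ∉ tsupport σ₁ := fun p hp =>
      ⟨fun h => disj p hp (pot₁.tsupport_θ h), fun h => disj p hp (pot₁.tsupport_σ h)⟩
    have z₂ : ∀ p ∉ B a, p ∉ tsupport θ₂ ∧ p ∉ tsupport σ₂ := fun p hp =>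
      ⟨fun h => hp (pot₂.tsupport_θ h), fun h => hp (pot₂.tsupport_σ h)⟩
    have mul0 : ∀ p, density θ₁ p * density θ₂ p = 0 := by
      intro p
      by_cases hp : p ∈ B a
      · rw [density_eq_zero (z₁ p hp).1, zero_mul]
      · rw [density_eq_zero (z₂ p hp).1, mul_zero]
    refine ⟨θ₁ + θ₂, σ₁ + σ₂, ?_, fun p => ?_, fun f hf => ?_, ?_⟩
    · refine (pot₁.mono ?_).add (pot₂.mono ?_) <;> simp
    · rw [lin_add pot₁.smooth_θ pot₂.smooth_θ pot₁.smooth_σ pot₂.smooth_σ]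
      by_cases hp : p ∈ B a
      · rw [lin_eq_zero (z₁ p hp).1 (z₁ p hp).2, zero_add]
        exact hull₂ p hp
      · rw [lin_eq_zero (z₂ p hp).1 (z₂ p hp).2, add_zero]
        exact hull₁ p
    · simp only [density_add pot₁.smooth_θ pot₂.smooth_θ, add_mul]
      rw [integral_add (integrable_density_mul pot₁ (hF f hf))
        (integrable_density_mul pot₂ (hF f hf))]
      refine (abs_add_le _ _).trans ?_
      linarith [small₁ f hf, small₂ f hf]
    · have : ∀ p, density (θ₁ + θ₂) p ^ 2 = density θ₁ p ^ 2 + density θ₂ p ^ 2 := fun p => by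
        rw [density_add pot₁.smooth_θ pot₂.smooth_θ]
        linear_combination 2 * mul0 p
      simp only [this]
      rw [integral_add (integrable_density_sq pot₁) (integrable_density_sq pot₂),
        Finset.sum_insert ha]
      linarith

/-- A strict subsolution can be perturbed inside `Ω`, weakly close to zero, with an `L²` norm
comparable to the total defect in `Ω`. -/
lemma exists_perturbation {Ω : Set E} (hΩ : IsOpen Ω) (hΩf : volume Ω ≠ ⊤) {θ σ : E → ℝ}
    (hθ : ContDiff ℝ ∞ θ) (hσ : ContDiff ℝ ∞ σ) (hz : ∀ p, base + lin θ σ p ∈ hull)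
    {F : List (E → ℝ)} (hF : ∀ f ∈ F, Integrable f) {ε : ℝ} (hε : 0 < ε) :
    ∃ θ' σ' : E → ℝ, IsPot Ω θ' σ' ∧ (∀ p, base + lin θ σ p + lin θ' σ' p ∈ hull) ∧
      (∀ f ∈ F, |∫ p, density θ' p * f p| ≤ ε) ∧
      1 / 16384 * ∫ p in Ω, (1 - density θ p ^ 2) ^ 2 ≤ ∫ p, density θ' p ^ 2 := by
  set g : E → ℝ := fun p => (1 - density θ p ^ 2) ^ 2 with hg
  have cg : Continuous g := by
    have := continuous_density hθ
    fun_prop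
  have hlt : ∀ p, density θ p ^ 2 < 1 := fun p => by
    have := (hz p).1
    simpa [base, lin] using this
  have g0 : ∀ p, 0 ≤ g p := fun p => sq_nonneg _
  have g1 : ∀ p, g p ≤ 1 := fun p => pow_le_one₀ (by linarith [hlt p])
    (by linarith [sq_nonneg (density θ p)])
  have ig : IntegrableOn g Ω :=
    Measure.integrableOn_of_bounded hΩf cg.aestronglyMeasurable (M := 1)
      (Eventually.of_forall fun p => by rw [Real.norm_of_nonneg (g0 p)]; exact g1 p)
  choose R hR hloc using fun x => exists_local_perturbation hθ hσ x (hz x)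
  have hball : ∀ x : E, ∃ d > 0, x ∈ Ω → closedBall x d ⊆ Ω := by
    intro x
    by_cases hx : x ∈ Ω
    · obtain ⟨d, hd, h⟩ := nhds_basis_closedBall.mem_iff.1 (hΩ.mem_nhds hx)
      exact ⟨d, hd, fun _ => h⟩
    · exact ⟨1, one_pos, fun h => (hx h).elim⟩
  choose d hd hdΩ using hball
  obtain ⟨t, r, tc, tΩ, hr, hcov, hdisj⟩ := Besicovitch.exists_disjoint_closedBall_covering_ae
    (volume : Measure E) (fun _ => Set.Ioi 0) Ω
    (fun x _ δ hδ => ⟨δ / 2, half_pos hδ, half_pos hδ, half_lt_self hδ⟩)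
    (fun x => min (R x) (d x)) (fun x _ => lt_min (hR x) (hd x))
  have hrR : ∀ x ∈ t, 0 < r x ∧ r x < R x ∧ closedBall x (r x) ⊆ Ω := fun x hx =>
    ⟨(hr x hx).1, (hr x hx).2.2.trans_le (min_le_left _ _),
      (closedBall_subset_closedBall ((hr x hx).2.2.le.trans (min_le_right _ _))).trans
        (hdΩ x (tΩ hx))⟩
  have : Countable t := tc.to_subtype
  have hsub : ⋃ x : t, closedBall (x : E) (r x) ⊆ Ω := Set.iUnion_subset fun x => (hrR x x.2).2.2
  have hsum : HasSum (fun x : t => ∫ p in closedBall (x : E) (r x), g p) (∫ p in Ω, g p) := by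
    have h := hasSum_integral_iUnion (μ := (volume : Measure E)) (f := g)
      (s := fun x : t => closedBall (x : E) (r x)) (fun x => measurableSet_closedBall)
      (fun x y hxy => hdisj x.2 y.2 (fun h => hxy (Subtype.ext h))) (ig.mono_set hsub)
    have hae : (⋃ x : t, closedBall (x : E) (r x)) =ᵐ[volume] Ω := by
      refine ae_eq_set.2 ⟨?_, ?_⟩
      · rw [Set.sdiff_eq_empty.2 hsub, measure_empty]
      · rw [← Set.biUnion_eq_iUnion t fun x _ => closedBall x (r x)]
        exact hcov
    rwa [setIntegral_congr_set hae] at h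
  have hfin : ∃ S : Finset t, 1 / 2 * ∫ p in Ω, g p
      ≤ ∑ x ∈ S, ∫ p in closedBall (x : E) (r x), g p := by
    rcases (setIntegral_nonneg (μ := volume) hΩ.measurableSet fun p _ => g0 p).eq_or_lt with h | h
    · exact ⟨∅, by simp [← h]⟩
    · obtain ⟨S, hS⟩ := (hsum.eventually (lt_mem_nhds (half_lt_self h))).exists
      exact ⟨S, by linarith⟩
  obtain ⟨S, hS⟩ := hfin
  obtain ⟨θ', σ', pot, h1, h2, h3⟩ := exists_sum_perturbation hF hz hε
    (fun x : t => closedBall (x : E) (r x))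
    (fun x : t => 1 / 8192 * ∫ p in closedBall (x : E) (r x), g p) S
    (fun x _ y _ hxy => hdisj x.2 y.2 (fun h => hxy (Subtype.ext h)))
    (fun x _ ε hε => hloc x (r x) (hrR x x.2).1 (hrR x x.2).2.1 F hF ε hε)
  refine ⟨θ', σ', pot.mono (Set.iUnion₂_subset fun x _ => (hrR x x.2).2.2), h1, h2, ?_⟩
  rw [← Finset.mul_sum] at h3
  linarith

lemma integrable_density {Ω : Set E} {θ σ : E → ℝ} (h : IsPot Ω θ σ) : Integrable (density θ) :=
  (continuous_density h.smooth_θ).integrable_of_hasCompactSupport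
    (hasCompactSupport_density h.compact_θ)

lemma base_mem_hull : base ∈ hull := by norm_num [base, hull]

/-- Iterated perturbations: the increments are nearly orthogonal to all previous densities and to
a given finite family of functions, and as large as the total defect permits. -/
lemma exists_iteration {Ω : Set E} (hΩ : IsOpen Ω) (hΩf : volume Ω ≠ ⊤)
    {F : List (E → ℝ)} (hF : ∀ f ∈ F, Integrable f) {ε : ℝ} (hε : 0 < ε) :
    ∃ θ σ : ℕ → E → ℝ, (∀ n, IsPot Ω (θ n) (σ n)) ∧
      (∀ n p, base + lin (θ n) (σ n) p ∈ hull) ∧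
      (∀ m n, m ≤ n → |∫ p, (density (θ (n + 1)) p - density (θ n) p) * density (θ m) p|
        ≤ ε * (1 / 2) ^ n) ∧
      (∀ f ∈ F, ∀ n, |∫ p, (density (θ (n + 1)) p - density (θ n) p) * f p|
        ≤ ε * (1 / 2) ^ n) ∧
      (∀ n, 1 / 16384 * ∫ p in Ω, (1 - density (θ n) p ^ 2) ^ 2
        ≤ ∫ p, (density (θ (n + 1)) p - density (θ n) p) ^ 2) ∧
      θ 0 = 0 := by
  let St := {z : (E → ℝ) × (E → ℝ) × List (E → ℝ) // IsPot Ω z.1 z.2.1 ∧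
    (∀ p, base + lin z.1 z.2.1 p ∈ hull) ∧ ∀ f ∈ z.2.2, Integrable f}
  have step : ∀ (n : ℕ) (z : St), ∃ z' : St,
      (∀ f ∈ z.1.2.2, |∫ p, (density z'.1.1 p - density z.1.1 p) * f p| ≤ ε * (1 / 2) ^ n) ∧
      1 / 16384 * ∫ p in Ω, (1 - density z.1.1 p ^ 2) ^ 2
        ≤ ∫ p, (density z'.1.1 p - density z.1.1 p) ^ 2 ∧
      z'.1.2.2 = density z'.1.1 :: z.1.2.2 := by
    rintro n ⟨⟨θ, σ, G⟩, pot, hz, hG⟩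
    obtain ⟨θ', σ', pot', h1, h2, h3⟩ := exists_perturbation hΩ hΩf pot.smooth_θ pot.smooth_σ hz hG
      (ε := ε * (1 / 2) ^ n) (by positivity)
    have pot2 := pot.add pot'
    have hd : ∀ p, density (θ + θ') p - density θ p = density θ' p := fun p => by
      rw [density_add pot.smooth_θ pot'.smooth_θ, add_sub_cancel_left]
    refine ⟨⟨⟨θ + θ', σ + σ', density (θ + θ') :: G⟩, pot2, fun p => ?_, fun f hf => ?_⟩,
      fun f hf => ?_, ?_, rfl⟩
    · rw [lin_add pot.smooth_θ pot'.smooth_θ pot.smooth_σ pot'.smooth_σ, ← add_assoc]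
      exact h1 p
    · rcases List.mem_cons.1 hf with rfl | hf
      · exact integrable_density pot2
      · exact hG f hf
    · simp only [hd]
      exact h2 f hf
    · simp only [hd]
      exact h3
  choose next hn1 hn2 hn3 using step
  have hz0 : ∀ p, base + lin 0 0 p ∈ hull := fun p => by
    rw [lin_eq_zero (θ := 0) (σ := 0) (by simp [tsupport]) (by simp [tsupport]), add_zero]
    exact base_mem_hull
  let z₀ : St := ⟨⟨0, 0, density 0 :: F⟩, isPot_zero _, hz0, fun f hf => by
    rcases List.mem_cons.1 hf with rfl | hf
    · exact integrable_density (isPot_zero Ω)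
    · exact hF f hf⟩
  let z : ℕ → St := fun n => Nat.rec z₀ next n
  have hmono : ∀ m n, m ≤ n → (z m).1.2.2 ⊆ (z n).1.2.2 := fun m n hmn => by
    induction n, hmn using Nat.le_induction with
    | base => exact List.Subset.refl _
    | succ n _ ih =>
      have : (z (n + 1)).1.2.2 = density (z (n + 1)).1.1 :: (z n).1.2.2 := hn3 n (z n)
      rw [this]
      exact List.subset_cons_of_subset _ ih
  have hmem : ∀ n, density (z n).1.1 ∈ (z n).1.2.2 := fun n => by
    cases n with
    | zero => exact List.mem_cons_self
    | succ n =>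
      have : (z (n + 1)).1.2.2 = density (z (n + 1)).1.1 :: (z n).1.2.2 := hn3 n (z n)
      rw [this]
      exact List.mem_cons_self
  refine ⟨fun n => (z n).1.1, fun n => (z n).1.2.1, fun n => (z n).2.1, fun n => (z n).2.2.1,
    fun m n hmn => hn1 n (z n) _ (hmono m n hmn (hmem m)),
    fun f hf n => hn1 n (z n) _ (hmono 0 n n.zero_le (List.mem_cons_of_mem _ hf)),
    fun n => hn2 n (z n), rfl⟩

/-- A bounded sequence in a Hilbert space whose increments are nearly orthogonal to all the
previous terms is a Cauchy sequence. -/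
lemma cauchySeq_of_almost_orthogonal {H : Type*} [NormedAddCommGroup H] [InnerProductSpace ℝ H]
    {x : ℕ → H} {M C : ℝ} (hM : ∀ n, ‖x n‖ ^ 2 ≤ M)
    (hC : ∀ m n, m ≤ n → |inner ℝ (x m) (x (n + 1) - x n)| ≤ C * (1 / 2) ^ n) :
    CauchySeq x := by
  have hC0 : 0 ≤ C := by simpa using (abs_nonneg _).trans (hC 0 0 le_rfl)
  have hinner : ∀ m n, m ≤ n →
      |inner ℝ (x m) (x n - x m)| ≤ 2 * C * (1 / 2) ^ m - 2 * C * (1 / 2) ^ n := by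
    intro m n hmn
    induction n, hmn using Nat.le_induction with
    | base => simp
    | succ n hmn ih =>
      have : x (n + 1) - x m = (x n - x m) + (x (n + 1) - x n) := by abel
      rw [this, inner_add_right]
      refine (abs_add_le _ _).trans ((add_le_add ih (hC m n hmn)).trans (le_of_eq ?_))
      rw [pow_succ]; ring
  have hexp : ∀ m n, ‖x n‖ ^ 2 = ‖x m‖ ^ 2 + 2 * inner ℝ (x m) (x n - x m) + ‖x n - x m‖ ^ 2 := by
    intro m n
    rw [← norm_add_sq_real, add_sub_cancel]
  set b : ℕ → ℝ := fun n => ‖x n‖ ^ 2 - 4 * C * (1 / 2) ^ n with hb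
  have hkey : ∀ m n, m ≤ n → ‖x n - x m‖ ^ 2 ≤ b n - b m := by
    intro m n hmn
    have h1 := hexp m n
    have h2 := (abs_le.1 (hinner m n hmn)).1
    simp only [hb]
    linarith
  have hmono : Monotone b := fun m n hmn => by
    have := hkey m n hmn
    nlinarith [sq_nonneg ‖x n - x m‖]
  have hbdd : BddAbove (Set.range b) := ⟨M, by
    rintro _ ⟨n, rfl⟩
    have : 0 ≤ 4 * C * (1 / 2) ^ n := by positivity
    simp only [hb]
    linarith [hM n]⟩
  have hlim := tendsto_atTop_ciSup hmono hbdd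
  refine cauchySeq_of_le_tendsto_0' (fun n => √((⨆ i, b i) - b n)) (fun n m hnm => ?_) ?_
  · rw [dist_comm, dist_eq_norm]
    refine Real.le_sqrt_of_sq_le ((hkey n m hnm).trans ?_)
    linarith [le_ciSup hbdd m]
  · have h := (Real.continuous_sqrt.tendsto 0).comp
      (by simpa using (tendsto_const_nhds (x := ⨆ i, b i)).sub hlim)
    rw [Real.sqrt_zero] at h
    exact h

section TendstoL2

variable {α : Type*} [MeasurableSpace α] {μ : Measure α}

/-- Convergence of square integrable functions in `L²`. -/
structure TendstoL2 (μ : Measure α) (f : ℕ → α → ℝ) (g : α → ℝ) : Prop where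
  memLp : ∀ n, MemLp (f n) 2 μ
  memLp_lim : MemLp g 2 μ
  tendsto : Tendsto (fun n => eLpNorm (f n - g) 2 μ) atTop (𝓝 0)

lemma inner_toLp {f g : α → ℝ} (hf : MemLp f 2 μ) (hg : MemLp g 2 μ) :
    inner ℝ (hf.toLp f) (hg.toLp g) = ∫ x, f x * g x ∂μ := by
  rw [L2.inner_def]
  refine integral_congr_ae ?_
  filter_upwards [hf.coeFn_toLp, hg.coeFn_toLp] with x h1 h2
  rw [h1, h2]
  simp [mul_comm]

lemma norm_toLp_sq {f : α → ℝ} (hf : MemLp f 2 μ) : ‖hf.toLp f‖ ^ 2 = ∫ x, f x ^ 2 ∂μ := by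
  rw [← real_inner_self_eq_norm_sq, inner_toLp]
  simp only [sq]

lemma exists_tendstoL2 {f : ℕ → α → ℝ} (hf : ∀ n, MemLp (f n) 2 μ)
    (hc : CauchySeq fun n => (hf n).toLp (f n)) : ∃ g, Measurable g ∧ TendstoL2 μ f g := by
  obtain ⟨l, hl⟩ := cauchySeq_tendsto_of_complete hc
  refine ⟨l, (Lp.stronglyMeasurable l).measurable, hf, Lp.memLp l, ?_⟩
  rwa [← Lp.toLp_coeFn l (Lp.memLp l), Lp.tendsto_Lp_iff_tendsto_eLpNorm''] at hl

lemma TendstoL2.tendsto_toLp {f : ℕ → α → ℝ} {g : α → ℝ} (h : TendstoL2 μ f g) :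
    Tendsto (fun n => (h.memLp n).toLp (f n)) atTop (𝓝 (h.memLp_lim.toLp g)) :=
  (Lp.tendsto_Lp_iff_tendsto_eLpNorm'' _ _ _ _).2 h.tendsto

lemma TendstoL2.integral_mul {f f' : ℕ → α → ℝ} {g g' : α → ℝ} (h : TendstoL2 μ f g)
    (h' : TendstoL2 μ f' g') :
    Tendsto (fun n => ∫ x, f n x * f' n x ∂μ) atTop (𝓝 (∫ x, g x * g' x ∂μ)) := by
  have := h.tendsto_toLp.inner (𝕜 := ℝ) h'.tendsto_toLp
  simpa only [inner_toLp] using this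

lemma tendstoL2_const {g : α → ℝ} (hg : MemLp g 2 μ) : TendstoL2 μ (fun _ => g) g :=
  ⟨fun _ => hg, hg, by simp⟩

lemma TendstoL2.mul_bdd {f : ℕ → α → ℝ} {g : α → ℝ} (h : TendstoL2 μ f g) {k : α → ℝ}
    (hk : AEStronglyMeasurable k μ) {C : ℝ} (hC : ∀ᵐ x ∂μ, |k x| ≤ C) :
    TendstoL2 μ (fun n x => f n x * k x) fun x => g x * k x := by
  have bd : ∀ u : α → ℝ, ∀ᵐ x ∂μ, ‖u x * k x‖ ≤ C * ‖u x‖ := fun u => by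
    filter_upwards [hC] with x hx
    rw [norm_mul, mul_comm C]
    exact mul_le_mul_of_nonneg_left hx (norm_nonneg _)
  refine ⟨fun n => (h.memLp n).of_le_mul ((h.memLp n).1.mul hk) (bd _),
    h.memLp_lim.of_le_mul (h.memLp_lim.1.mul hk) (bd _), ?_⟩
  have lim : Tendsto (fun n => ENNReal.ofReal C * eLpNorm (f n - g) 2 μ) atTop (𝓝 0) := by
    simpa using ENNReal.Tendsto.const_mul h.tendsto (Or.inr ENNReal.ofReal_ne_top)
  refine tendsto_of_tendsto_of_tendsto_of_le_of_le tendsto_const_nhds lim (fun _ => zero_le)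
    fun n => ?_
  refine eLpNorm_le_mul_eLpNorm_of_ae_le_mul ?_ 2
  filter_upwards [bd (f n - g)] with x hx
  simpa only [Pi.sub_apply, sub_mul] using hx

lemma TendstoL2.restrict {f : ℕ → α → ℝ} {g : α → ℝ} (h : TendstoL2 μ f g) (s : Set α) :
    TendstoL2 (μ.restrict s) f g :=
  ⟨fun n => (h.memLp n).restrict s, h.memLp_lim.restrict s,
    tendsto_of_tendsto_of_tendsto_of_le_of_le tendsto_const_nhds h.tendsto (fun _ => zero_le)
      fun _ => eLpNorm_restrict_le _ _ _ _⟩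

lemma TendstoL2.comp {f : ℕ → α → ℝ} {g : α → ℝ} (h : TendstoL2 μ f g) {u : ℕ → ℕ}
    (hu : Tendsto u atTop atTop) : TendstoL2 μ (fun n => f (u n)) g :=
  ⟨fun n => h.memLp (u n), h.memLp_lim, h.tendsto.comp hu⟩

lemma TendstoL2.exists_subseq {f : ℕ → α → ℝ} {g : α → ℝ} (h : TendstoL2 μ f g) :
    ∃ u : ℕ → ℕ, StrictMono u ∧ ∀ᵐ x ∂μ, Tendsto (fun n => f (u n) x) atTop (𝓝 (g x)) :=
  (tendstoInMeasure_of_tendsto_eLpNorm two_ne_zero (fun n => (h.memLp n).1) h.memLp_lim.1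
    h.tendsto).exists_seq_tendsto_ae

end TendstoL2

lemma memLp_two_of_continuous {f : E → ℝ} (hf : Continuous f) (hc : HasCompactSupport f) :
    MemLp f 2 volume := hf.memLp_of_hasCompactSupport hc

lemma memLp_density {Ω : Set E} {θ σ : E → ℝ} (h : IsPot Ω θ σ) : MemLp (density θ) 2 volume :=
  memLp_two_of_continuous (continuous_density h.smooth_θ) (hasCompactSupport_density h.compact_θ)

lemma memLp_vel₁ {Ω : Set E} {θ σ : E → ℝ} (h : IsPot Ω θ σ) : MemLp (vel₁ θ) 2 volume :=
  memLp_two_of_continuous (continuous_vel₁ h.smooth_θ)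
    (hasCompactSupport_D (hasCompactSupport_D h.compact_θ _) _)

lemma memLp_vel₂ {Ω : Set E} {θ σ : E → ℝ} (h : IsPot Ω θ σ) : MemLp (vel₂ θ) 2 volume :=
  memLp_two_of_continuous (continuous_vel₂ h.smooth_θ)
    (hasCompactSupport_D (hasCompactSupport_D h.compact_θ _) _).neg

lemma density_sq_lt_one {θ σ : E → ℝ} {p : E} (h : base + lin θ σ p ∈ hull) :
    density θ p ^ 2 < 1 := by
  simpa [base, lin] using h.1

/-- `(ρ, v₁, v₂)` is a strong limit of strict subsolutions whose defect in `Ω` vanishes in the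
limit. -/
structure IsLimit (Ω : Set E) (θ σ : ℕ → E → ℝ) (ρ v₁ v₂ : E → ℝ) : Prop where
  isPot : ∀ n, IsPot Ω (θ n) (σ n)
  mem_hull : ∀ n p, base + lin (θ n) (σ n) p ∈ hull
  measurable_density : Measurable ρ
  measurable_vel₁ : Measurable v₁
  measurable_vel₂ : Measurable v₂
  tendsto_density : TendstoL2 volume (fun n => density (θ n)) ρ
  tendsto_vel₁ : TendstoL2 volume (fun n => vel₁ (θ n)) v₁
  tendsto_vel₂ : TendstoL2 volume (fun n => vel₂ (θ n)) v₂
  tendsto_defect : Tendsto (fun n => ∫ p in Ω, (1 - density (θ n) p ^ 2) ^ 2) atTop (𝓝 0)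

/-- The iteration converges strongly to a limit with vanishing defect. -/
lemma exists_isLimit {Ω : Set E} (hΩ : IsOpen Ω) (hΩf : volume Ω ≠ ⊤)
    {F : List (E → ℝ)} (hF : ∀ f ∈ F, Integrable f ∧ MemLp f 2) {ε : ℝ} (hε : 0 < ε) :
    ∃ (θ σ : ℕ → E → ℝ) (ρ v₁ v₂ : E → ℝ), IsLimit Ω θ σ ρ v₁ v₂ ∧
      ∀ f ∈ F, |∫ p, ρ p * f p| ≤ 2 * ε := by
  obtain ⟨θ, σ, pot, hz, horth, hweak, hdef, h0⟩ :=
    exists_iteration hΩ hΩf (fun f hf => (hF f hf).1) hε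
  have mρ := fun n => memLp_density (pot n)
  have m₁ := fun n => memLp_vel₁ (pot n)
  have m₂ := fun n => memLp_vel₂ (pot n)
  have bdd : ∀ n, ‖(mρ n).toLp _‖ ^ 2 ≤ volume.real Ω := by
    intro n
    rw [norm_toLp_sq]
    have : ∫ p, Ω.indicator (fun _ : E => (1 : ℝ)) p = volume.real Ω := by
      rw [integral_indicator hΩ.measurableSet, setIntegral_const, smul_eq_mul, mul_one]
    rw [← this]
    refine integral_mono (integrable_density_sq (pot n))
      ((integrableOn_const hΩf).integrable_indicator hΩ.measurableSet) fun p => ?_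
    by_cases hp : p ∈ Ω
    · simp only [Set.indicator_of_mem hp]
      exact (density_sq_lt_one (hz n p)).le
    · simp only [Set.indicator_of_notMem hp]
      rw [density_eq_zero fun h => hp ((pot n).tsupport_θ h)]
      norm_num
  have cau : CauchySeq fun n => (mρ n).toLp _ := by
    refine cauchySeq_of_almost_orthogonal bdd (C := ε) fun m n hmn => ?_
    rw [← MemLp.toLp_sub, inner_toLp]
    simpa only [Pi.sub_apply, mul_comm] using horth m n hmn
  have hvel : ∀ m n, (∫ p, (vel₁ (θ m) p - vel₁ (θ n) p) ^ 2 ≤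
        ∫ p, (density (θ m) p - density (θ n) p) ^ 2) ∧
      (∫ p, (vel₂ (θ m) p - vel₂ (θ n) p) ^ 2 ≤
        ∫ p, (density (θ m) p - density (θ n) p) ^ 2) := by
    intro m n
    have key := integral_velocity_sq_le (volume : Measure E)
      ((pot m).smooth_θ.sub (pot n).smooth_θ)
      ((pot m).compact_θ.sub (pot n).compact_θ) e₁ e₂
    have key' : ∀ a b p,
        D a (D b fun x => θ m x - θ n x) p = D a (D b (θ m)) p - D a (D b (θ n)) p :=
      fun a b p => D_D_sub (pot m).smooth_θ (pot n).smooth_θ a b p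
    simp only [key'] at key
    have i1 : Integrable fun p => (vel₁ (θ m) p - vel₁ (θ n) p) ^ 2 :=
      ((m₁ m).sub (m₁ n)).integrable_sq
    have i2 : Integrable fun p => (vel₂ (θ m) p - vel₂ (θ n) p) ^ 2 :=
      ((m₂ m).sub (m₂ n)).integrable_sq
    have e : ∫ p, (vel₁ (θ m) p - vel₁ (θ n) p) ^ 2 + (vel₂ (θ m) p - vel₂ (θ n) p) ^ 2 ≤
        ∫ p, (density (θ m) p - density (θ n) p) ^ 2 := by
      refine le_trans (le_of_eq ?_) (key.trans (le_of_eq ?_))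
      · congr 1; ext p; simp only [vel₁, vel₂]; ring
      · congr 1; ext p; simp only [density]; ring
    rw [integral_add i1 i2] at e
    have p1 : 0 ≤ ∫ p, (vel₁ (θ m) p - vel₁ (θ n) p) ^ 2 := integral_nonneg fun p => sq_nonneg _
    have p2 : 0 ≤ ∫ p, (vel₂ (θ m) p - vel₂ (θ n) p) ^ 2 := integral_nonneg fun p => sq_nonneg _
    exact ⟨by linarith, by linarith⟩
  have hdist : ∀ {f : ℕ → E → ℝ} (hf : ∀ n, MemLp (f n) 2 volume),
      (∀ m n, ∫ p, (f m p - f n p) ^ 2 ≤ ∫ p, (density (θ m) p - density (θ n) p) ^ 2) →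
      CauchySeq fun n => (hf n).toLp (f n) := by
    intro f hf hle
    rw [Metric.cauchySeq_iff] at cau ⊢
    intro η hη
    obtain ⟨N, hN⟩ := cau η hη
    refine ⟨N, fun m hm n hn => lt_of_le_of_lt ?_ (hN m hm n hn)⟩
    rw [dist_eq_norm, dist_eq_norm, ← MemLp.toLp_sub, ← MemLp.toLp_sub]
    refine le_of_sq_le_sq ?_ (norm_nonneg _)
    rw [norm_toLp_sq, norm_toLp_sq]
    exact hle m n
  obtain ⟨ρ, hρ, tρ⟩ := exists_tendstoL2 mρ cau
  obtain ⟨v₁, hv₁, t₁⟩ := exists_tendstoL2 m₁ (hdist m₁ fun m n => (hvel m n).1)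
  obtain ⟨v₂, hv₂, t₂⟩ := exists_tendstoL2 m₂ (hdist m₂ fun m n => (hvel m n).2)
  refine ⟨θ, σ, ρ, v₁, v₂, ⟨pot, hz, hρ, hv₁, hv₂, tρ, t₁, t₂, ?_⟩, fun f hf => ?_⟩
  · have l1 := tρ.tendsto_toLp
    have l2 := (((l1.comp (tendsto_add_atTop_nat 1)).sub l1).norm.pow 2).const_mul 16384
    rw [sub_self, norm_zero] at l2
    refine tendsto_of_tendsto_of_tendsto_of_le_of_le tendsto_const_nhds
      (by simpa using l2) (fun n => integral_nonneg fun p => sq_nonneg _) fun n => ?_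
    have := hdef n
    rw [← MemLp.toLp_sub, norm_toLp_sq]
    simp only [Pi.sub_apply]
    linarith
  · have lim := (tρ.integral_mul (tendstoL2_const (hF f hf).2)).abs
    refine le_of_tendsto lim (Eventually.of_forall fun n => ?_)
    have : ∀ n, |∫ p, density (θ n) p * f p| ≤ 2 * ε - 2 * ε * (1 / 2) ^ n := by
      intro n
      induction n with
      | zero =>
        have : ∀ p, density (θ 0) p = 0 := fun p => by
          rw [h0]
          exact density_eq_zero (by simp [tsupport])
        simp [this]
      | succ n ih =>
        have h1 := hweak f hf n
        have i1 := integrable_density_mul (pot (n + 1)) (hF f hf).1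
        have i2 := integrable_density_mul (pot n) (hF f hf).1
        simp only [sub_mul] at h1
        rw [integral_sub i1 i2] at h1
        rw [pow_succ]
        rw [abs_le] at *
        constructor <;> linarith
    have p : 0 ≤ 2 * ε * (1 / 2) ^ n := by positivity
    linarith [this n]

section PartialDerivatives

lemma hasDerivAt_slice {φ : E → ℝ} (hφ : ContDiff ℝ ∞ φ) {c : ℝ → E} {a : E} {s : ℝ}
    (hc : HasDerivAt c a s) : HasDerivAt (fun s => φ (c s)) (D a φ (c s)) s :=
  ((hφ.differentiable (by simp)) (c s)).hasFDerivAt.comp_hasDerivAt s hc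

lemma hasDerivAt_fst_slice {φ : E → ℝ} (hφ : ContDiff ℝ ∞ φ) (p : E) (s : ℝ) :
    HasDerivAt (fun s => φ (s, p.2.1, p.2.2)) (D e₁ φ (s, p.2.1, p.2.2)) s :=
  hasDerivAt_slice hφ (c := fun s => (s, p.2.1, p.2.2))
    ((hasDerivAt_id s).prodMk ((hasDerivAt_const s p.2.1).prodMk (hasDerivAt_const s p.2.2)))

lemma hasDerivAt_snd_slice {φ : E → ℝ} (hφ : ContDiff ℝ ∞ φ) (p : E) (s : ℝ) :
    HasDerivAt (fun s => φ (p.1, s, p.2.2)) (D e₂ φ (p.1, s, p.2.2)) s :=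
  hasDerivAt_slice hφ (c := fun s => (p.1, s, p.2.2))
    ((hasDerivAt_const s p.1).prodMk ((hasDerivAt_id s).prodMk (hasDerivAt_const s p.2.2)))

lemma hasDerivAt_time_slice {φ : E → ℝ} (hφ : ContDiff ℝ ∞ φ) (p : E) (s : ℝ) :
    HasDerivAt (fun s => φ (p.1, p.2.1, s)) (D e₃ φ (p.1, p.2.1, s)) s :=
  hasDerivAt_slice hφ (c := fun s => (p.1, p.2.1, s))
    ((hasDerivAt_const s p.1).prodMk ((hasDerivAt_const s p.2.1).prodMk (hasDerivAt_id s)))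

lemma dx1_eq_D {φ : E → ℝ} (hφ : ContDiff ℝ ∞ φ) (p : E) : dx1 φ p = D e₁ φ p :=
  (hasDerivAt_fst_slice hφ p p.1).deriv

lemma dx2_eq_D {φ : E → ℝ} (hφ : ContDiff ℝ ∞ φ) (p : E) : dx2 φ p = D e₂ φ p :=
  (hasDerivAt_snd_slice hφ p p.2.1).deriv

lemma dt_eq_D {φ : E → ℝ} (hφ : ContDiff ℝ ∞ φ) (p : E) : dt φ p = D e₃ φ p :=
  (hasDerivAt_time_slice hφ p p.2.2).deriv

end PartialDerivatives

/-- The part of the fundamental domain with times in `(0, T)`. -/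
def cell (T : ℝ) : Set E := Set.Ioo (0 : ℝ) 1 ×ˢ (Set.Ioo (0 : ℝ) 1 ×ˢ Set.Ioo (0 : ℝ) T)

lemma isOpen_cell (T : ℝ) : IsOpen (cell T) := isOpen_Ioo.prod (isOpen_Ioo.prod isOpen_Ioo)

lemma volume_cell (T : ℝ) : volume (cell T) = ENNReal.ofReal T := by
  rw [cell, Measure.volume_eq_prod, Measure.prod_prod, Measure.volume_eq_prod, Measure.prod_prod]
  simp

lemma volume_cell_ne_top (T : ℝ) : volume (cell T) ≠ ⊤ := by simp [volume_cell]

lemma exists_bound_on_cell (T : ℝ) {f : E → ℝ} (hf : Continuous f) :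
    ∃ C, 0 ≤ C ∧ ∀ p ∈ cell T, |f p| ≤ C := by
  have hK : IsCompact (Set.Icc (0 : ℝ) 1 ×ˢ (Set.Icc (0 : ℝ) 1 ×ˢ Set.Icc (0 : ℝ) T)) :=
    isCompact_Icc.prod (isCompact_Icc.prod isCompact_Icc)
  obtain ⟨C, hC⟩ := hK.exists_bound_of_continuousOn hf.continuousOn
  refine ⟨max C 0, le_max_right _ _, fun p hp => (hC p ?_).trans (le_max_left _ _)⟩
  exact Set.prod_mono Set.Ioo_subset_Icc_self
    (Set.prod_mono Set.Ioo_subset_Icc_self Set.Ioo_subset_Icc_self) hp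

lemma setIntegral_cell_D_e₂ {T : ℝ} {φ : E → ℝ} (hφ : ContDiff ℝ ∞ φ) (hper : SpacePeriodic φ) :
    ∫ p in cell T, D e₂ φ p = 0 := by
  have hc : Continuous (D e₂ φ) := (contDiff_D hφ e₂).continuous
  obtain ⟨C, hC0, hC⟩ := exists_bound_on_cell T hc
  have hint : IntegrableOn (D e₂ φ) (cell T) :=
    Measure.integrableOn_of_bounded (volume_cell_ne_top T) hc.aestronglyMeasurable
      (ae_restrict_of_forall_mem (isOpen_cell T).measurableSet hC)
  rw [cell, Measure.volume_eq_prod, setIntegral_prod _ hint]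
  refine setIntegral_eq_zero_of_forall_eq_zero fun x hx => ?_
  have hint2 : Integrable (fun y : ℝ × ℝ => D e₂ φ (x, y))
      ((volume.restrict (Set.Ioo (0 : ℝ) 1)).prod (volume.restrict (Set.Ioo (0 : ℝ) T))) := by
    rw [Measure.prod_restrict]
    refine Measure.integrableOn_of_bounded (M := C) ?_
      (Continuous.aestronglyMeasurable (by fun_prop)) ?_
    · rw [Measure.prod_prod]; simp
    · exact ae_restrict_of_forall_mem (measurableSet_Ioo.prod measurableSet_Ioo)
        fun y hy => hC (x, y) ⟨hx, hy⟩
  rw [Measure.volume_eq_prod, ← Measure.prod_restrict, integral_prod_symm _ hint2]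
  refine integral_eq_zero_of_ae (Eventually.of_forall fun t => ?_)
  simp only [Pi.zero_apply]
  rw [← integral_Ioc_eq_integral_Ioo, ← intervalIntegral.integral_of_le zero_le_one,
    intervalIntegral.integral_eq_sub_of_hasDerivAt
      (fun s _ => hasDerivAt_snd_slice hφ (x, 0, t) s)
      ((Continuous.intervalIntegrable (by fun_prop) _ _))]
  have := (hper (x, 0, t)).2
  simp only [zero_add] at this ⊢
  rw [this, sub_self]

section LinearSystem

variable {Ω : Set E} {θ σ φ : E → ℝ}

lemma integrable_D_D_mul (hθ : ContDiff ℝ ∞ θ) (hc : HasCompactSupport θ) (hφ : ContDiff ℝ ∞ φ)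
    (a b c : E) : Integrable fun p => D a (D b θ) p * D c φ p :=
  integrable_mul_of_hasCompactSupport volume (continuous_D_D hθ a b)
    (hasCompactSupport_D (hasCompactSupport_D hc _) _) (contDiff_D hφ c).continuous

lemma integrable_D_mul (hθ : ContDiff ℝ ∞ θ) (hc : HasCompactSupport θ) (hφ : ContDiff ℝ ∞ φ)
    (a c : E) : Integrable fun p => D a θ p * D c φ p :=
  integrable_mul_of_hasCompactSupport volume (contDiff_D hθ a).continuous
    (hasCompactSupport_D hc _) (contDiff_D hφ c).continuous

lemma integral_transport (h : IsPot Ω θ σ) (hφ : ContDiff ℝ ∞ φ) :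
    ∫ p, (density θ p * D e₃ φ p + mom₁ θ σ p * D e₁ φ p + mom₂ θ σ p * D e₂ φ p) = 0 := by
  have i := fun a b c => integrable_D_D_mul h.smooth_θ h.compact_θ hφ a b c
  have j := fun a b => integrable_D_mul h.smooth_σ h.compact_σ hφ a b
  have k := fun a b c => integral_D_mul_D_comm volume (contDiff_D h.smooth_θ c)
    (hasCompactSupport_D h.compact_θ c) hφ a b
  have l := fun a b => integral_D_mul_D_comm volume h.smooth_σ h.compact_σ hφ a b
  have e : ∀ p, density θ p * D e₃ φ p + mom₁ θ σ p * D e₁ φ p + mom₂ θ σ p * D e₂ φ p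
      = (D e₁ (D e₁ θ) p * D e₃ φ p - D e₃ (D e₁ θ) p * D e₁ φ p)
        + (D e₂ (D e₂ θ) p * D e₃ φ p - D e₃ (D e₂ θ) p * D e₂ φ p)
        + (D e₁ σ p * D e₂ φ p - D e₂ σ p * D e₁ φ p) := fun p => by
    simp only [density, mom₁, mom₂]; ring
  simp only [e]
  have i' : ∀ a b c a' b' c',
      Integrable fun p => D a (D b θ) p * D c φ p - D a' (D b' θ) p * D c' φ p :=
    fun a b c a' b' c' => (i a b c).sub (i a' b' c')
  have j' : Integrable fun p => D e₁ σ p * D e₂ φ p - D e₂ σ p * D e₁ φ p := (j _ _).sub (j _ _)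
  have s : Integrable fun p => (D e₁ (D e₁ θ) p * D e₃ φ p - D e₃ (D e₁ θ) p * D e₁ φ p)
      + (D e₂ (D e₂ θ) p * D e₃ φ p - D e₃ (D e₂ θ) p * D e₂ φ p) := (i' ..).add (i' ..)
  rw [integral_add s j', integral_add (i' ..) (i' ..), integral_sub (i _ _ _) (i _ _ _),
    integral_sub (i _ _ _) (i _ _ _), integral_sub (j _ _) (j _ _), k e₁ e₃ e₁, k e₂ e₃ e₂,
    l e₁ e₂]
  ring

lemma integral_divergence (h : IsPot Ω θ σ) (hφ : ContDiff ℝ ∞ φ) :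
    ∫ p, (vel₁ θ p * D e₁ φ p + vel₂ θ p * D e₂ φ p) = 0 := by
  have i := fun a b c => integrable_D_D_mul h.smooth_θ h.compact_θ hφ a b c
  have k := integral_D_mul_D_comm volume (contDiff_D h.smooth_θ e₁)
    (hasCompactSupport_D h.compact_θ e₁) hφ e₂ e₁
  have e : ∀ p, vel₁ θ p * D e₁ φ p + vel₂ θ p * D e₂ φ p
      = D e₂ (D e₁ θ) p * D e₁ φ p - D e₁ (D e₁ θ) p * D e₂ φ p := fun p => by
    simp only [vel₁, vel₂, D_comm h.smooth_θ e₁ e₂]; ring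
  simp only [e]
  rw [integral_sub (i _ _ _) (i _ _ _), k, sub_self]

lemma integral_darcy (h : IsPot Ω θ σ) (hφ : ContDiff ℝ ∞ φ) :
    ∫ p, (vel₁ θ p * -D e₂ φ p + (vel₂ θ p + density θ p) * D e₁ φ p) = 0 := by
  have i := fun a b c => integrable_D_D_mul h.smooth_θ h.compact_θ hφ a b c
  have k := integral_D_mul_D_comm volume (contDiff_D h.smooth_θ e₂)
    (hasCompactSupport_D h.compact_θ e₂) hφ e₂ e₁
  have e : ∀ p, vel₁ θ p * -D e₂ φ p + (vel₂ θ p + density θ p) * D e₁ φ p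
      = D e₂ (D e₂ θ) p * D e₁ φ p - D e₁ (D e₂ θ) p * D e₂ φ p := fun p => by
    simp only [vel₁, vel₂, density]; ring
  simp only [e]
  rw [integral_sub (i _ _ _) (i _ _ _), k, sub_self]

end LinearSystem

section Limit

variable {T : ℝ} {θ σ : ℕ → E → ℝ} {ρ v₁ v₂ : E → ℝ}

instance isFiniteMeasure_cell (T : ℝ) : IsFiniteMeasure (volume.restrict (cell T)) :=
  isFiniteMeasure_restrict.2 (volume_cell_ne_top T)

lemma measurableSet_cell (T : ℝ) : MeasurableSet (cell T) := (isOpen_cell T).measurableSet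

lemma integrableOn_cell {f : E → ℝ} (hf : Continuous f) : IntegrableOn f (cell T) := by
  obtain ⟨C, -, hC⟩ := exists_bound_on_cell T hf
  exact Measure.integrableOn_of_bounded (volume_cell_ne_top T) hf.aestronglyMeasurable
    (ae_restrict_of_forall_mem (measurableSet_cell T) hC)

lemma memLp_cell {f : E → ℝ} (hf : Continuous f) : MemLp f 2 (volume.restrict (cell T)) := by
  obtain ⟨C, -, hC⟩ := exists_bound_on_cell T hf
  exact MemLp.of_bound hf.aestronglyMeasurable C
    (ae_restrict_of_forall_mem (measurableSet_cell T) hC)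

lemma TendstoL2.mul_continuous {f : ℕ → E → ℝ} {g : E → ℝ}
    (h : TendstoL2 (volume.restrict (cell T)) f g) {k : E → ℝ} (hk : Continuous k) :
    TendstoL2 (volume.restrict (cell T)) (fun n p => f n p * k p) fun p => g p * k p := by
  obtain ⟨C, -, hC⟩ := exists_bound_on_cell T hk
  exact h.mul_bdd hk.aestronglyMeasurable (ae_restrict_of_forall_mem (measurableSet_cell T) hC)

lemma IsLimit.sq_eq_one (h : IsLimit (cell T) θ σ ρ v₁ v₂) :
    ∀ᵐ p ∂volume.restrict (cell T), ρ p ^ 2 = 1 := by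
  obtain ⟨u, hu, hlim⟩ := (h.tendsto_density.restrict (cell T)).exists_subseq
  have hlim2 : ∀ᵐ p ∂volume.restrict (cell T),
      Tendsto (fun n => (1 - density (θ (u n)) p ^ 2) ^ 2) atTop (𝓝 ((1 - ρ p ^ 2) ^ 2)) := by
    filter_upwards [hlim] with p hp
    exact (tendsto_const_nhds.sub (hp.pow 2)).pow 2
  have hb : ∀ n p, ‖(1 - density (θ (u n)) p ^ 2) ^ 2‖ ≤ 1 := fun n p => by
    have h1 := density_sq_lt_one (h.mem_hull (u n) p)
    rw [Real.norm_of_nonneg (sq_nonneg _)]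
    exact pow_le_one₀ (by linarith) (by linarith [sq_nonneg (density (θ (u n)) p)])
  have hm : ∀ n, AEStronglyMeasurable (fun p => (1 - density (θ (u n)) p ^ 2) ^ 2)
      (volume.restrict (cell T)) := fun n => by
    have := continuous_density (h.isPot (u n)).smooth_θ
    exact Continuous.aestronglyMeasurable (by fun_prop)
  have lim1 := tendsto_integral_of_dominated_convergence (fun _ => (1 : ℝ)) hm
    (integrable_const _) (fun n => Eventually.of_forall (hb n)) hlim2
  have eq0 := tendsto_nhds_unique lim1 (h.tendsto_defect.comp hu.tendsto_atTop)
  have hint : Integrable (fun p => (1 - ρ p ^ 2) ^ 2) (volume.restrict (cell T)) := by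
    have := h.measurable_density
    refine Integrable.of_bound (C := 1) (Measurable.aestronglyMeasurable (by fun_prop)) ?_
    filter_upwards [hlim2] with p hp
    exact le_of_tendsto hp.norm (Eventually.of_forall fun n => hb n p)
  rw [integral_eq_zero_iff_of_nonneg (fun p => sq_nonneg _) hint] at eq0
  filter_upwards [eq0] with p hp
  have : 1 - ρ p ^ 2 = 0 := pow_eq_zero_iff two_ne_zero |>.1 hp
  linarith

lemma IsLimit.tendsto_integral_defect (h : IsLimit (cell T) θ σ ρ v₁ v₂) :
    Tendsto (fun n => ∫ p in cell T, (1 - density (θ n) p ^ 2)) atTop (𝓝 0) := by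
  have t := h.tendsto_density.restrict (cell T)
  have lim := (tendsto_const_nhds (x := ∫ p in cell T, (1 : ℝ))).sub (t.integral_mul t)
  have e : ∫ p in cell T, ρ p * ρ p = ∫ p in cell T, (1 : ℝ) :=
    integral_congr_ae (h.sq_eq_one.mono fun p hp => by simpa [sq] using hp)
  rw [e, sub_self] at lim
  refine lim.congr fun n => ?_
  have hc := continuous_density (h.isPot n).smooth_θ
  rw [← integral_sub (integrable_const _) (integrableOn_cell (by fun_prop))]
  simp only [sq]

lemma setIntegral_eq_zero_of_support {Ω : Set E} {f : E → ℝ} (hf : ∫ p, f p = 0)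
    (h0 : ∀ p, p ∉ Ω → f p = 0) : ∫ p in Ω, f p = 0 := by
  rw [setIntegral_eq_integral_of_forall_compl_eq_zero h0, hf]

lemma setIntegral_mul_add_mul {f g k l : E → ℝ} (hf : MemLp f 2 (volume.restrict (cell T)))
    (hg : MemLp g 2 (volume.restrict (cell T))) (hk : MemLp k 2 (volume.restrict (cell T)))
    (hl : MemLp l 2 (volume.restrict (cell T))) :
    (∫ p in cell T, f p * k p) + (∫ p in cell T, g p * l p)
      = ∫ p in cell T, (f p * k p + g p * l p) :=
  (integral_add (hf.integrable_mul hk) (hg.integrable_mul hl)).symm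

lemma setIntegral_mul_add_mul_add_mul {f g j k l m : E → ℝ}
    (hf : MemLp f 2 (volume.restrict (cell T))) (hg : MemLp g 2 (volume.restrict (cell T)))
    (hj : MemLp j 2 (volume.restrict (cell T))) (hk : MemLp k 2 (volume.restrict (cell T)))
    (hl : MemLp l 2 (volume.restrict (cell T))) (hm : MemLp m 2 (volume.restrict (cell T))) :
    (∫ p in cell T, f p * k p) + (∫ p in cell T, g p * l p) + (∫ p in cell T, j p * m p)
      = ∫ p in cell T, (f p * k p + g p * l p + j p * m p) := by
  rw [setIntegral_mul_add_mul hf hg hk hl]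
  exact (integral_add ((hf.integrable_mul hk).add (hg.integrable_mul hl))
    (hj.integrable_mul hm)).symm

lemma vel_eq_zero {θ : E → ℝ} {p : E} (hp : p ∉ tsupport θ) : vel₁ θ p = 0 ∧ vel₂ θ p = 0 := by
  simp [vel₁, vel₂, D_D_eq_zero_of_notMem hp]

lemma IsLimit.integral_divergence (h : IsLimit (cell T) θ σ ρ v₁ v₂) {φ : E → ℝ}
    (hφ : ContDiff ℝ ∞ φ) : ∫ p in cell T, (v₁ p * D e₁ φ p + v₂ p * D e₂ φ p) = 0 := by
  have t₁ := h.tendsto_vel₁.restrict (cell T)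
  have t₂ := h.tendsto_vel₂.restrict (cell T)
  have k₁ := tendstoL2_const (memLp_cell (T := T) (contDiff_D hφ e₁).continuous)
  have k₂ := tendstoL2_const (memLp_cell (T := T) (contDiff_D hφ e₂).continuous)
  have lim := (t₁.integral_mul k₁).add (t₂.integral_mul k₂)
  rw [setIntegral_mul_add_mul t₁.memLp_lim t₂.memLp_lim k₁.memLp_lim k₂.memLp_lim] at lim
  refine tendsto_nhds_unique lim (tendsto_const_nhds.congr fun n => ?_)
  rw [setIntegral_mul_add_mul (t₁.memLp n) (t₂.memLp n) k₁.memLp_lim k₂.memLp_lim]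
  refine (setIntegral_eq_zero_of_support (IPM.integral_divergence (h.isPot n) hφ)
    fun p hp => ?_).symm
  obtain ⟨z₁, z₂⟩ := vel_eq_zero fun h' => hp ((h.isPot n).tsupport_θ h')
  rw [z₁, z₂]; ring

lemma IsLimit.integral_darcy (h : IsLimit (cell T) θ σ ρ v₁ v₂) {φ : E → ℝ}
    (hφ : ContDiff ℝ ∞ φ) :
    ∫ p in cell T, (v₁ p * -D e₂ φ p + (v₂ p + ρ p) * D e₁ φ p) = 0 := by
  have t₀ := h.tendsto_density.restrict (cell T)
  have t₁ := h.tendsto_vel₁.restrict (cell T)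
  have t₂ := h.tendsto_vel₂.restrict (cell T)
  have k₁ := tendstoL2_const (memLp_cell (T := T) (contDiff_D hφ e₁).continuous)
  have k₂ := tendstoL2_const (memLp_cell (T := T) (contDiff_D hφ e₂).continuous.neg)
  have lim := ((t₁.integral_mul k₂).add (t₂.integral_mul k₁)).add (t₀.integral_mul k₁)
  rw [setIntegral_mul_add_mul_add_mul t₁.memLp_lim t₂.memLp_lim t₀.memLp_lim k₂.memLp_lim
    k₁.memLp_lim k₁.memLp_lim] at lim
  simp only [add_mul, ← add_assoc]
  refine tendsto_nhds_unique lim (tendsto_const_nhds.congr fun n => ?_)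
  rw [setIntegral_mul_add_mul_add_mul (t₁.memLp n) (t₂.memLp n) (t₀.memLp n) k₂.memLp_lim
    k₁.memLp_lim k₁.memLp_lim]
  have key := setIntegral_eq_zero_of_support (Ω := cell T) (IPM.integral_darcy (h.isPot n) hφ)
    fun p hp => by
      obtain ⟨z₁, z₂⟩ := vel_eq_zero fun h' => hp ((h.isPot n).tsupport_θ h')
      rw [z₁, z₂, density_eq_zero fun h' => hp ((h.isPot n).tsupport_θ h')]; ring
  simp only [add_mul, ← add_assoc] at key
  exact key.symm

lemma abs_le_of_mem_hull {θ σ : E → ℝ} {p : E} (h : base + lin θ σ p ∈ hull) :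
    |density θ p * vel₁ θ p - mom₁ θ σ p| ≤ 1 - density θ p ^ 2 ∧
      |density θ p * vel₂ θ p - mom₂ θ σ p + 1 / 2| ≤ 1 - density θ p ^ 2 := by
  obtain ⟨h1, h2⟩ := h
  simp only [base, lin, Prod.mk_add_mk, zero_add] at h1 h2
  set d := (1 - density θ p ^ 2) / 2 with hd
  have hd0 : 0 < d := by rw [hd]; linarith
  have a1 : |mom₁ θ σ p - density θ p * vel₁ θ p| ≤ d :=
    abs_le_of_sq_le_sq (by nlinarith [sq_nonneg (-1 / 2 + mom₂ θ σ p - density θ p * vel₂ θ p + d)])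
      hd0.le
  have a2 : |-1 / 2 + mom₂ θ σ p - density θ p * vel₂ θ p + d| ≤ d :=
    abs_le_of_sq_le_sq (by nlinarith [sq_nonneg (mom₁ θ σ p - density θ p * vel₁ θ p)]) hd0.le
  rw [abs_le] at a1 a2
  rw [abs_le, abs_le]
  refine ⟨⟨?_, ?_⟩, ?_, ?_⟩ <;> linarith

lemma IsLimit.integral_transport (h : IsLimit (cell T) θ σ ρ v₁ v₂) {φ : E → ℝ}
    (hφ : ContDiff ℝ ∞ φ) (hper : SpacePeriodic φ) :
    ∫ p in cell T, ρ p * (D e₃ φ p + v₁ p * D e₁ φ p + v₂ p * D e₂ φ p) = 0 := by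
  have c₁ := (contDiff_D hφ e₁).continuous
  have c₂ := (contDiff_D hφ e₂).continuous
  have c₃ := (contDiff_D hφ e₃).continuous
  have t₀ := h.tendsto_density.restrict (cell T)
  have t₁ := (h.tendsto_vel₁.restrict (cell T)).mul_continuous c₁
  have t₂ := (h.tendsto_vel₂.restrict (cell T)).mul_continuous c₂
  have k₃ := tendstoL2_const (memLp_cell (T := T) c₃)
  have lim := ((t₀.integral_mul k₃).add (t₀.integral_mul t₁)).add (t₀.integral_mul t₂)
  rw [setIntegral_mul_add_mul_add_mul t₀.memLp_lim t₀.memLp_lim t₀.memLp_lim k₃.memLp_lim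
    t₁.memLp_lim t₂.memLp_lim] at lim
  simp only [mul_add]
  refine tendsto_nhds_unique lim ?_
  obtain ⟨C₁, hC₁0, hC₁⟩ := exists_bound_on_cell T c₁
  obtain ⟨C₂, hC₂0, hC₂⟩ := exists_bound_on_cell T c₂
  have bound := h.tendsto_integral_defect.const_mul (C₁ + C₂)
  rw [mul_zero] at bound
  refine squeeze_zero_norm (fun n => ?_) bound
  have d₀ := continuous_density (h.isPot n).smooth_θ
  have d₁ := continuous_vel₁ (h.isPot n).smooth_θ
  have d₂ := continuous_vel₂ (h.isPot n).smooth_θ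
  have f₁ := continuous_mom₁ (h.isPot n).smooth_θ (h.isPot n).smooth_σ
  have f₂ := continuous_mom₂ (h.isPot n).smooth_θ (h.isPot n).smooth_σ
  have key := setIntegral_eq_zero_of_support (Ω := cell T) (IPM.integral_transport (h.isPot n) hφ)
    fun p hp => by
      have z := lin_eq_zero (fun h' => hp ((h.isPot n).tsupport_θ h'))
        (fun h' => hp ((h.isPot n).tsupport_σ h'))
      simp only [lin, Prod.mk_eq_zero] at z
      rw [z.1, z.2.2.2.1, z.2.2.2.2]; ring
  have base0 : ∫ p in cell T, 1 / 2 * D e₂ φ p = 0 := by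
    rw [integral_const_mul, setIntegral_cell_D_e₂ hφ hper, mul_zero]
  have e : (∫ p in cell T, density (θ n) p * D e₃ φ p)
      + (∫ p in cell T, density (θ n) p * (vel₁ (θ n) p * D e₁ φ p))
      + (∫ p in cell T, density (θ n) p * (vel₂ (θ n) p * D e₂ φ p))
      = ∫ p in cell T, ((density (θ n) p * vel₁ (θ n) p - mom₁ (θ n) (σ n) p) * D e₁ φ p
        + (density (θ n) p * vel₂ (θ n) p - mom₂ (θ n) (σ n) p + 1 / 2) * D e₂ φ p) := by
    rw [← integral_add (integrableOn_cell (by fun_prop)) (integrableOn_cell (by fun_prop)),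
      ← integral_add (integrableOn_cell (by fun_prop)) (integrableOn_cell (by fun_prop)),
      ← sub_zero (∫ p in cell T, _ + _), ← key,
      ← integral_sub (integrableOn_cell (by fun_prop)) (integrableOn_cell (by fun_prop)),
      ← add_zero (∫ p in cell T, _ - _), ← base0,
      ← integral_add (integrableOn_cell (by fun_prop)) (integrableOn_cell (by fun_prop))]
    congr 1
    ext p
    ring
  rw [e, ← integral_const_mul]
  refine norm_integral_le_of_norm_le (integrableOn_cell (by fun_prop))
    (ae_restrict_of_forall_mem (measurableSet_cell T) fun p hp => ?_)
  obtain ⟨b₁, b₂⟩ := abs_le_of_mem_hull (h.mem_hull n p)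
  refine (norm_add_le _ _).trans ?_
  rw [norm_mul, norm_mul, add_mul, mul_comm C₁, mul_comm C₂]
  have := (abs_nonneg _).trans b₁
  gcongr
  · exact b₁
  · exact hC₁ p hp
  · exact b₂
  · exact hC₂ p hp

end Limit

section Slices

lemma D_slice {f : E → ℝ} (hf : ContDiff ℝ ∞ f) (t : ℝ) (a x : ℝ × ℝ) :
    D a (fun x : ℝ × ℝ => f (x.1, x.2, t)) x = D (a.1, a.2, 0) f (x.1, x.2, t) := by
  have h1 : HasFDerivAt (fun x : ℝ × ℝ => ((x.1, x.2, t) : E))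
      ((ContinuousLinearMap.fst ℝ ℝ ℝ).prod ((ContinuousLinearMap.snd ℝ ℝ ℝ).prod 0)) x :=
    hasFDerivAt_fst.prodMk (hasFDerivAt_snd.prodMk (hasFDerivAt_const t x))
  have h2 := ((hf.differentiable (by simp)) (x.1, x.2, t)).hasFDerivAt.comp x h1
  exact congrArg (fun L => L a) h2.fderiv

lemma contDiff_slice {f : E → ℝ} (hf : ContDiff ℝ ∞ f) (t : ℝ) :
    ContDiff ℝ ∞ fun x : ℝ × ℝ => f (x.1, x.2, t) :=
  hf.comp (contDiff_fst.prodMk (contDiff_snd.prodMk contDiff_const))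

lemma hasCompactSupport_slice {f : E → ℝ} (hf : HasCompactSupport f) (t : ℝ) :
    HasCompactSupport fun x : ℝ × ℝ => f (x.1, x.2, t) := by
  refine HasCompactSupport.intro
    (hf.isCompact.image (f := fun p : E => (p.1, p.2.1)) (by fun_prop)) fun x hx => ?_
  exact image_eq_zero_of_notMem_tsupport fun h => hx ⟨_, h, rfl⟩

/-- At every time the squared velocity is controlled by the squared density. -/
lemma IsPot.lintegral_slice_le {T : ℝ} {θ σ : E → ℝ} (h : IsPot (cell T) θ σ)
    (hh : ∀ p, base + lin θ σ p ∈ hull) (t : ℝ) :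
    ∫⁻ x : ℝ × ℝ, ENNReal.ofReal (vel₁ θ (x.1, x.2, t) ^ 2 + vel₂ θ (x.1, x.2, t) ^ 2) ≤ 1 := by
  set g : ℝ × ℝ → ℝ := fun x => θ (x.1, x.2, t) with hg
  have gs : ContDiff ℝ ∞ g := contDiff_slice h.smooth_θ t
  have gc : HasCompactSupport g := hasCompactSupport_slice h.compact_θ t
  have dd : ∀ a b : ℝ × ℝ, ∀ x, D a (D b g) x
      = D (a.1, a.2, 0) (D (b.1, b.2, 0) θ) (x.1, x.2, t) := fun a b x => by
    have : D b g = fun x => D (b.1, b.2, 0) θ (x.1, x.2, t) :=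
      funext fun y => D_slice h.smooth_θ t b y
    rw [this, D_slice (contDiff_D h.smooth_θ _)]
  have key := integral_velocity_sq_le volume gs gc ((1, 0) : ℝ × ℝ) (0, 1)
  have e1 : ∀ x : ℝ × ℝ, vel₁ θ (x.1, x.2, t) ^ 2 + vel₂ θ (x.1, x.2, t) ^ 2
      = D (1, 0) (D (0, 1) g) x ^ 2 + D (1, 0) (D (1, 0) g) x ^ 2 := fun x => by
    rw [dd, dd]; simp only [vel₁, vel₂, e₁, e₂]; ring
  have e2 : ∀ x : ℝ × ℝ, (D (1, 0) (D (1, 0) g) x + D (0, 1) (D (0, 1) g) x) ^ 2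
      = density θ (x.1, x.2, t) ^ 2 := fun x => by
    rw [dd, dd]; simp only [density, e₁, e₂]
  simp only [e2] at key
  simp only [e1]
  have dint : ∀ a b : ℝ × ℝ, Integrable fun x => D a (D b g) x ^ 2 := fun a b => by
    have hc := (contDiff_D (contDiff_D gs b) a).continuous
    simp only [sq]
    exact integrable_mul_of_hasCompactSupport volume hc
      (hasCompactSupport_D (hasCompactSupport_D gc b) a) hc
  have sint : Integrable fun x => D (1, 0) (D (0, 1) g) x ^ 2 + D (1, 0) (D (1, 0) g) x ^ 2 :=
    (dint _ _).add (dint _ _)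
  rw [← ofReal_integral_eq_lintegral_ofReal sint
    (Eventually.of_forall fun x => by positivity)]
  refine ENNReal.ofReal_le_one.2 (key.trans ?_)
  set Q : Set (ℝ × ℝ) := Set.Ioo (0 : ℝ) 1 ×ˢ Set.Ioo (0 : ℝ) 1 with hQ
  have vQ : volume Q = 1 := by
    rw [hQ, Measure.volume_eq_prod, Measure.prod_prod]; simp
  have z : ∀ x, x ∉ Q → density θ (x.1, x.2, t) ^ 2 = 0 := fun x hx => by
    rw [density_eq_zero fun h' => hx ?_]
    · simp
    · have := h.tsupport_θ h'
      exact ⟨this.1, this.2.1⟩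
  rw [← setIntegral_eq_integral_of_forall_compl_eq_zero z]
  have := norm_setIntegral_le_of_norm_le_const (μ := volume) (s := Q)
    (f := fun x : ℝ × ℝ => density θ (x.1, x.2, t) ^ 2) (C := 1) (by rw [vQ]; simp)
    fun x _ => by
      rw [Real.norm_of_nonneg (sq_nonneg _)]
      exact (density_sq_lt_one (hh _)).le
  rw [Measure.real, vQ] at this
  simpa using (le_abs_self _).trans this

lemma ae_ae_slice {P : E → Prop} (h : ∀ᵐ p : E, P p) :
    ∀ᵐ t : ℝ, ∀ᵐ x : ℝ × ℝ, P (x.1, x.2, t) := by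
  have m : MeasurePreserving (fun z : ℝ × (ℝ × ℝ) => ((z.2.1, z.2.2, z.1) : E)) volume volume :=
    (volume_preserving_prodAssoc (α₁ := ℝ) (β₁ := ℝ) (γ₁ := ℝ)).comp
      (Measure.measurePreserving_swap (μ := (volume : Measure ℝ))
        (ν := (volume : Measure (ℝ × ℝ))))
  exact Measure.ae_ae_of_ae_prod (m.quasiMeasurePreserving.ae h)

lemma IsLimit.ae_lintegral_slice_le {T : ℝ} {θ σ : ℕ → E → ℝ} {ρ v₁ v₂ : E → ℝ}
    (h : IsLimit (cell T) θ σ ρ v₁ v₂) :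
    ∀ᵐ t : ℝ, ∫⁻ x : ℝ × ℝ,
      ENNReal.ofReal (v₁ (x.1, x.2, t) ^ 2 + v₂ (x.1, x.2, t) ^ 2) ≤ 1 := by
  obtain ⟨u, hu, l₁⟩ := h.tendsto_vel₁.exists_subseq
  obtain ⟨w, hw, l₂⟩ := (h.tendsto_vel₂.comp hu.tendsto_atTop).exists_subseq
  have l : ∀ᵐ p : E, Tendsto (fun n => ENNReal.ofReal
      (vel₁ (θ (u (w n))) p ^ 2 + vel₂ (θ (u (w n))) p ^ 2)) atTop
      (𝓝 (ENNReal.ofReal (v₁ p ^ 2 + v₂ p ^ 2))) := by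
    filter_upwards [l₁, l₂] with p h₁ h₂
    exact (ENNReal.continuous_ofReal.tendsto _).comp
      (((h₁.comp hw.tendsto_atTop).pow 2).add (h₂.pow 2))
  filter_upwards [ae_ae_slice l] with t ht
  calc ∫⁻ x : ℝ × ℝ, ENNReal.ofReal (v₁ (x.1, x.2, t) ^ 2 + v₂ (x.1, x.2, t) ^ 2)
      = ∫⁻ x : ℝ × ℝ, liminf (fun n => ENNReal.ofReal (vel₁ (θ (u (w n))) (x.1, x.2, t) ^ 2
          + vel₂ (θ (u (w n))) (x.1, x.2, t) ^ 2)) atTop :=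
        lintegral_congr_ae (ht.mono fun x hx => hx.liminf_eq.symm)
    _ ≤ liminf (fun n => ∫⁻ x : ℝ × ℝ, ENNReal.ofReal (vel₁ (θ (u (w n))) (x.1, x.2, t) ^ 2
          + vel₂ (θ (u (w n))) (x.1, x.2, t) ^ 2)) atTop :=
        lintegral_liminf_le fun n => by
          have c₁ := continuous_vel₁ (h.isPot (u (w n))).smooth_θ
          have c₂ := continuous_vel₂ (h.isPot (u (w n))).smooth_θ
          exact (ENNReal.continuous_ofReal.comp (by fun_prop)).measurable
    _ ≤ 1 := liminf_le_of_le (by isBoundedDefault) fun b hb => by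
        obtain ⟨n, hn⟩ := hb.exists
        exact hn.trans ((h.isPot _).lintegral_slice_le (h.mem_hull _) t)

end Slices

/-- The representative of a point in the fundamental domain. -/
noncomputable def wrap (p : E) : E := (Int.fract p.1, Int.fract p.2.1, p.2.2)

lemma measurable_wrap : Measurable wrap :=
  (measurable_fract.comp measurable_fst).prodMk
    ((measurable_fract.comp (measurable_fst.comp measurable_snd)).prodMk
      (measurable_snd.comp measurable_snd))

lemma spacePeriodic_wrap : SpacePeriodic wrap := fun p => by
  simp [wrap, Int.fract_add_one]

lemma wrap_eq_self {p : E} (h₁ : p.1 ∈ Set.Ioo (0 : ℝ) 1) (h₂ : p.2.1 ∈ Set.Ioo (0 : ℝ) 1) :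
    wrap p = p := by
  simp [wrap, Int.fract_eq_self.2 ⟨h₁.1.le, h₁.2⟩, Int.fract_eq_self.2 ⟨h₂.1.le, h₂.2⟩]

/-- The kinetic energy of a velocity field at time `t`. -/
noncomputable def energy (v₁ v₂ : E → ℝ) (t : ℝ) : ℝ≥0∞ :=
  ∫⁻ x : ℝ × ℝ, ENNReal.ofReal (v₁ (x.1, x.2, t) ^ 2 + v₂ (x.1, x.2, t) ^ 2)

lemma measurable_energy {v₁ v₂ : E → ℝ} (h₁ : Measurable v₁) (h₂ : Measurable v₂) :
    Measurable (energy v₁ v₂) :=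
  Measurable.lintegral_prod_right'
    (f := fun z : ℝ × (ℝ × ℝ) =>
      ENNReal.ofReal (v₁ (z.2.1, z.2.2, z.1) ^ 2 + v₂ (z.2.1, z.2.2, z.1) ^ 2))
    (by fun_prop)

open Classical in
/-- The periodic density with values `±1` determined by `ρ` at times in `(0, T)`. -/
noncomputable def periodicDensity (T : ℝ) (ρ : E → ℝ) (p : E) : ℝ :=
  if p.2.2 ∈ Set.Ioo 0 T then if 0 ≤ ρ (wrap p) then 1 else -1 else 0

open Classical in
/-- The periodic velocity determined by `v₁` and `v₂` at the times in `(0, T)` of small energy. -/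
noncomputable def periodicVelocity (T : ℝ) (v₁ v₂ : E → ℝ) (p : E) : ℝ × ℝ :=
  if p.2.2 ∈ Set.Ioo 0 T ∧ energy v₁ v₂ p.2.2 ≤ 1 then (v₁ (wrap p), v₂ (wrap p)) else 0

/-- The properties required of a solution on the time interval `(0, T)`. -/
def IsSolution (T : ℝ) (z : (E → ℝ) × (E → ℝ × ℝ)) : Prop :=
  Measurable z.1 ∧ Measurable z.2 ∧ SpacePeriodic z.1 ∧ SpacePeriodic z.2 ∧
    (∃ C : ℝ, ∀ p, |z.1 p| ≤ C) ∧
    (∃ C : ℝ, ∀ t : ℝ, (∫ x in Set.Ioo (0 : ℝ) 1 ×ˢ Set.Ioo (0 : ℝ) 1,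
      ((z.2 (x.1, x.2, t)).1 ^ 2 + (z.2 (x.1, x.2, t)).2 ^ 2)) ≤ C) ∧
    WeakIPMTorus z.1 z.2 ∧
    (∀ᵐ p : E, p.2.2 ∈ Set.Ioo 0 T → |z.1 p| = 1) ∧
    (∀ᵐ p : E, (p.2.2 < 0 ∨ T < p.2.2) → z.1 p = 0 ∧ z.2 p = 0)

section Periodic

variable {T : ℝ} {ρ v₁ v₂ : E → ℝ}

lemma measurable_periodicDensity (h : Measurable ρ) : Measurable (periodicDensity T ρ) :=
  Measurable.ite (measurableSet_Ioo.preimage (measurable_snd.comp measurable_snd))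
    (Measurable.ite (measurableSet_le measurable_const (h.comp measurable_wrap))
      measurable_const measurable_const) measurable_const

lemma measurable_periodicVelocity (h₁ : Measurable v₁) (h₂ : Measurable v₂) :
    Measurable (periodicVelocity T v₁ v₂) :=
  Measurable.ite
    ((measurableSet_Ioo.preimage (measurable_snd.comp measurable_snd)).inter
      (measurableSet_le ((measurable_energy h₁ h₂).comp (measurable_snd.comp measurable_snd))
        measurable_const))
    ((h₁.comp measurable_wrap).prodMk (h₂.comp measurable_wrap)) measurable_const

lemma spacePeriodic_periodicDensity : SpacePeriodic (periodicDensity T ρ) := fun p => by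
  obtain ⟨a, b⟩ := spacePeriodic_wrap p
  simp only [periodicDensity, a, b, and_self]

lemma spacePeriodic_periodicVelocity : SpacePeriodic (periodicVelocity T v₁ v₂) := fun p => by
  obtain ⟨a, b⟩ := spacePeriodic_wrap p
  simp only [periodicVelocity, a, b, and_self]

lemma abs_periodicDensity {p : E} (hp : p.2.2 ∈ Set.Ioo 0 T) : |periodicDensity T ρ p| = 1 := by
  rw [periodicDensity, if_pos hp]
  split_ifs <;> simp

lemma periodicDensity_eq_zero {p : E} (hp : p.2.2 ∉ Set.Ioo 0 T) : periodicDensity T ρ p = 0 := by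
  rw [periodicDensity, if_neg hp]

lemma periodicVelocity_eq_zero {p : E} (hp : p.2.2 ∉ Set.Ioo 0 T) :
    periodicVelocity T v₁ v₂ p = 0 := by
  rw [periodicVelocity, if_neg fun h => hp h.1]

lemma abs_periodicDensity_le (p : E) : |periodicDensity T ρ p| ≤ 1 := by
  by_cases hp : p.2.2 ∈ Set.Ioo 0 T
  · exact (abs_periodicDensity hp).le
  · simp [periodicDensity_eq_zero hp]

lemma integral_periodicVelocity_sq_le (h₁ : Measurable v₁) (h₂ : Measurable v₂) (t : ℝ) :
    ∫ x in Set.Ioo (0 : ℝ) 1 ×ˢ Set.Ioo (0 : ℝ) 1,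
      ((periodicVelocity T v₁ v₂ (x.1, x.2, t)).1 ^ 2
        + (periodicVelocity T v₁ v₂ (x.1, x.2, t)).2 ^ 2) ≤ 1 := by
  by_cases ht : t ∈ Set.Ioo 0 T ∧ energy v₁ v₂ t ≤ 1
  · rw [setIntegral_congr_fun (g := fun x => v₁ (x.1, x.2, t) ^ 2 + v₂ (x.1, x.2, t) ^ 2)
      (measurableSet_Ioo.prod measurableSet_Ioo) fun x hx => ?_]
    · rw [integral_eq_lintegral_of_nonneg_ae (Eventually.of_forall fun x => by positivity)
        (Measurable.aestronglyMeasurable (by fun_prop))]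
      exact ENNReal.toReal_le_of_le_ofReal zero_le_one
        ((setLIntegral_le_lintegral _ _).trans (ht.2.trans (by simp)))
    · simp only [periodicVelocity, if_pos ht, wrap_eq_self (p := (x.1, x.2, t)) hx.1 hx.2]
  · simp only [periodicVelocity, if_neg ht]
    simp

lemma setIntegral_QT_eq {f : E → ℝ} (hf : ∀ p : E, p.2.2 ∉ Set.Ioo 0 T → f p = 0) :
    ∫ p in QT, f p = ∫ p in cell T, f p := by
  refine setIntegral_eq_of_subset_of_forall_sdiff_eq_zero
    (measurableSet_Ioo.prod (measurableSet_Ioo.prod MeasurableSet.univ))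
    (Set.prod_mono_right (Set.prod_mono_right (Set.subset_univ _))) fun p hp => hf p fun h => ?_
  exact hp.2 ⟨hp.1.1, hp.1.2.1, h⟩

end Periodic

section Limit

variable {T : ℝ} {θ σ : ℕ → E → ℝ} {ρ v₁ v₂ : E → ℝ}

lemma IsLimit.periodicDensity_ae_eq (h : IsLimit (cell T) θ σ ρ v₁ v₂) :
    ∀ᵐ p ∂volume.restrict (cell T), periodicDensity T ρ p = ρ p := by
  filter_upwards [h.sq_eq_one, ae_restrict_mem (measurableSet_cell T)] with p hp hc
  rw [periodicDensity, if_pos hc.2.2, wrap_eq_self hc.1 hc.2.1]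
  rcases mul_self_eq_one_iff.1 ((sq (ρ p)).symm.trans hp) with h | h <;> simp [h]

lemma IsLimit.periodicVelocity_ae_eq (h : IsLimit (cell T) θ σ ρ v₁ v₂) :
    ∀ᵐ p ∂volume.restrict (cell T), periodicVelocity T v₁ v₂ p = (v₁ p, v₂ p) := by
  have q : ∀ᵐ p : E, energy v₁ v₂ p.2.2 ≤ 1 :=
    (Measure.quasiMeasurePreserving_snd.comp Measure.quasiMeasurePreserving_snd).ae
      h.ae_lintegral_slice_le
  filter_upwards [ae_restrict_of_ae q, ae_restrict_mem (measurableSet_cell T)] with p hp hc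
  rw [periodicVelocity, if_pos ⟨hc.2.2, hp⟩, wrap_eq_self hc.1 hc.2.1]

lemma IsLimit.weakIPMTorus (h : IsLimit (cell T) θ σ ρ v₁ v₂) :
    WeakIPMTorus (periodicDensity T ρ) (periodicVelocity T v₁ v₂) := by
  rintro φ ⟨hφ, hper, -⟩
  refine ⟨?_, ?_, ?_⟩
  · rw [setIntegral_QT_eq (T := T) fun p hp => by simp [periodicDensity_eq_zero hp],
      ← h.integral_transport hφ hper]
    refine integral_congr_ae ?_
    filter_upwards [h.periodicDensity_ae_eq, h.periodicVelocity_ae_eq] with p a b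
    rw [a, b, dt_eq_D hφ, dx1_eq_D hφ, dx2_eq_D hφ]
  · rw [setIntegral_QT_eq (T := T) fun p hp => by simp [periodicVelocity_eq_zero hp],
      ← h.integral_divergence hφ]
    refine integral_congr_ae ?_
    filter_upwards [h.periodicVelocity_ae_eq] with p b
    rw [b, dx1_eq_D hφ, dx2_eq_D hφ]
  · rw [setIntegral_QT_eq (T := T) fun p hp => by
      simp [periodicVelocity_eq_zero hp, periodicDensity_eq_zero hp], ← h.integral_darcy hφ]
    refine integral_congr_ae ?_
    filter_upwards [h.periodicDensity_ae_eq, h.periodicVelocity_ae_eq] with p a b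
    rw [a, b, dx1_eq_D hφ, dx2_eq_D hφ]

lemma IsLimit.isSolution (h : IsLimit (cell T) θ σ ρ v₁ v₂) :
    IsSolution T (periodicDensity T ρ, periodicVelocity T v₁ v₂) := by
  refine ⟨measurable_periodicDensity h.measurable_density,
    measurable_periodicVelocity h.measurable_vel₁ h.measurable_vel₂,
    spacePeriodic_periodicDensity, spacePeriodic_periodicVelocity, ⟨1, abs_periodicDensity_le⟩,
    ⟨1, integral_periodicVelocity_sq_le h.measurable_vel₁ h.measurable_vel₂⟩, h.weakIPMTorus,
    Eventually.of_forall fun p => abs_periodicDensity, Eventually.of_forall fun p hp => ?_⟩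
  have hp' : p.2.2 ∉ Set.Ioo 0 T := fun h' => by
    rcases hp with hp | hp
    · exact hp.not_gt h'.1
    · exact hp.not_gt h'.2
  exact ⟨periodicDensity_eq_zero hp', periodicVelocity_eq_zero hp'⟩

end Limit

/-- There are solutions almost orthogonal to finitely many given densities. -/
lemma exists_isSolution {T : ℝ} (hT : 0 < T) (F : List (E → ℝ))
    (hF : ∀ f ∈ F, Measurable f ∧ ∃ C : ℝ, ∀ p, |f p| ≤ C) :
    ∃ z, IsSolution T z ∧ ∀ f ∈ F, |∫ p in cell T, f p * z.1 p| ≤ T / 2 := by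
  have hF' : ∀ g ∈ F.map fun f => (cell T).indicator f, Integrable g ∧ MemLp g 2 := by
    intro g hg
    obtain ⟨f, hf, rfl⟩ := List.mem_map.1 hg
    obtain ⟨hm, C, hC⟩ := hF f hf
    have b : ∀ q : ℝ≥0∞, MemLp ((cell T).indicator f) q := fun q =>
      (memLp_indicator_iff_restrict (measurableSet_cell T)).2
        (MemLp.of_bound hm.aestronglyMeasurable C (Eventually.of_forall hC))
    exact ⟨memLp_one_iff_integrable.1 (b 1), b 2⟩
  obtain ⟨θ, σ, ρ, v₁, v₂, h, hρ⟩ := exists_isLimit (isOpen_cell T) (volume_cell_ne_top T) hF'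
    (ε := T / 4) (by linarith)
  refine ⟨_, h.isSolution, fun f hf => ?_⟩
  have key := hρ _ (List.mem_map_of_mem hf)
  have e : ∫ p, ρ p * (cell T).indicator f p
      = ∫ p in cell T, f p * periodicDensity T ρ p := by
    rw [← setIntegral_eq_integral_of_forall_compl_eq_zero (s := cell T)
      fun p hp => by rw [Set.indicator_of_notMem hp, mul_zero]]
    refine integral_congr_ae ?_
    filter_upwards [h.periodicDensity_ae_eq, ae_restrict_mem (measurableSet_cell T)] with p a hp
    rw [a, Set.indicator_of_mem hp, mul_comm]
  rw [e] at key
  linarith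

lemma IsSolution.integral_sq {T : ℝ} (hT : 0 < T) {z : (E → ℝ) × (E → ℝ × ℝ)}
    (h : IsSolution T z) : ∫ p in cell T, z.1 p * z.1 p = T := by
  obtain ⟨-, -, -, -, -, -, -, h, -⟩ := h
  have e : ∫ p in cell T, z.1 p * z.1 p = ∫ _ in cell T, (1 : ℝ) := by
    refine integral_congr_ae ?_
    filter_upwards [ae_restrict_of_ae h, ae_restrict_mem (measurableSet_cell T)] with p hp hc
    rw [← abs_mul_abs_self, hp hc.2.2, one_mul]
  simp [e, Measure.real, volume_cell, hT.le]

lemma IsSolution.not_ae_eq {T : ℝ} (hT : 0 < T) {y z : (E → ℝ) × (E → ℝ × ℝ)}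
    (hy : IsSolution T y) (h : |∫ p in cell T, y.1 p * z.1 p| ≤ T / 2) :
    ¬ ∀ᵐ p : E, y.1 p = z.1 p ∧ y.2 p = z.2 p := fun hyz => by
  have e : ∫ p in cell T, y.1 p * z.1 p = T := by
    refine (integral_congr_ae ?_).trans (hy.integral_sq hT)
    filter_upwards [ae_restrict_of_ae hyz] with p hp
    rw [hp.1]
  rw [e, abs_of_pos hT] at h
  linarith

end IPM

theorem stmt9 (T : ℝ) (hT : 0 < T) :
    ∃ S : Set ((ℝ × ℝ × ℝ → ℝ) × (ℝ × ℝ × ℝ → ℝ × ℝ)), S.Infinite ∧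
      (∀ z₁ ∈ S, ∀ z₂ ∈ S, z₁ ≠ z₂ →
        ¬ (∀ᵐ p : ℝ × ℝ × ℝ, z₁.1 p = z₂.1 p ∧ z₁.2 p = z₂.2 p)) ∧
      ∀ z ∈ S,
        Measurable z.1 ∧ Measurable z.2 ∧
        SpacePeriodic z.1 ∧ SpacePeriodic z.2 ∧
        -- ρ ∈ L^∞(𝕋² × ℝ)
        (∃ C : ℝ, ∀ p, |z.1 p| ≤ C) ∧
        -- v ∈ L^∞(ℝ; L²(𝕋²))
        (∃ C : ℝ, ∀ t : ℝ,
          (∫ x in Set.Ioo (0 : ℝ) 1 ×ˢ Set.Ioo (0 : ℝ) 1,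
            ((z.2 (x.1, x.2, t)).1 ^ 2 + (z.2 (x.1, x.2, t)).2 ^ 2)) ≤ C) ∧
        WeakIPMTorus z.1 z.2 ∧
        -- |ρ| = 1 a.e. on 𝕋² × (0,T)
        (∀ᵐ p : ℝ × ℝ × ℝ, p.2.2 ∈ Set.Ioo 0 T → |z.1 p| = 1) ∧
        -- ρ = 0 and v = 0 for a.e. t outside [0,T]
        (∀ᵐ p : ℝ × ℝ × ℝ, (p.2.2 < 0 ∨ T < p.2.2) → z.1 p = 0 ∧ z.2 p = 0) := by
  obtain ⟨s, hs, hsep⟩ := exists_seq_of_forall_finset_exists (IPM.IsSolution T)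
    (fun y z => |∫ p in IPM.cell T, y.1 p * z.1 p| ≤ T / 2) fun A hA => by
      obtain ⟨z, hz, h⟩ := IPM.exists_isSolution hT (A.toList.map Prod.fst) (by
        simp only [List.mem_map, Finset.mem_toList]
        rintro f ⟨y, hy, rfl⟩
        exact ⟨(hA y hy).1, (hA y hy).2.2.2.2.1⟩)
      exact ⟨z, hz, fun y hy => h _ (List.mem_map_of_mem (Finset.mem_toList.2 hy))⟩
  have ne : ∀ m n, m ≠ n → ¬ ∀ᵐ p, (s m).1 p = (s n).1 p ∧ (s m).2 p = (s n).2 p := by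
    intro m n hmn
    rcases hmn.lt_or_gt with h | h
    · exact (hs m).not_ae_eq hT (hsep m n h)
    · exact fun e => (hs n).not_ae_eq hT (hsep n m h) (e.mono fun p hp => ⟨hp.1.symm, hp.2.symm⟩)
  refine ⟨Set.range s, Set.infinite_range_of_injective fun m n e => ?_, ?_, ?_⟩
  · by_contra hmn
    exact ne m n hmn (by simp [e])
  · rintro _ ⟨m, rfl⟩ _ ⟨n, rfl⟩ hmn
    exact ne m n fun e => hmn (by rw [e])
  · rintro _ ⟨n, rfl⟩
    exact hs n
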